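/- arXiv:1711.02147 — 2 statements merged into one kernel-verified Lean document; each statement's English description precedes it below -/
import Mathlib

section
/- Let n be a prime and let H be a finitely generated subgroup of SL(n,ℤ). If φ_q(H) = SL(n,ℤ/qℤ) for one prime q > 3, then φ_p(H) = SL(n,ℤ/pℤ) for all but finitely many primes p. -/
open Matrix

/-- `SL n R` : the special linear group of `n × n` matrices over `R`. -/
abbrev SL (n : ℕ) (R : Type*) [CommRing R] := Matrix.SpecialLinearGroup (Fin n) R

/-- The reduction-mod-`p` homomorphism `φ_p : SL(n,ℤ) → SL(n,ℤ/pℤ)`. -/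
def redMod (n p : ℕ) : SL n ℤ →* SL n (ZMod p) :=
  Matrix.SpecialLinearGroup.map (Int.castRingHom (ZMod p))

/-- The rational matrix underlying an element of `SL(n,ℤ)`. -/
def matQ {n : ℕ} (g : SL n ℤ) : Matrix (Fin n) (Fin n) ℚ :=
  (g : Matrix (Fin n) (Fin n) ℤ).map ((↑) : ℤ → ℚ)

/-- A subgroup of `SL(n,ℤ)` is absolutely irreducible over `ℚ` if its elements generate the
full matrix algebra over `ℚ`. -/
def AbsIrredQ {n : ℕ} (H : Subgroup (SL n ℤ)) : Prop :=
  Algebra.adjoin ℚ (matQ '' (H : Set (SL n ℤ))) = ⊤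

/-- A subgroup of `SL(n, ℤ/pℤ)` is absolutely irreducible if its elements generate the
full matrix algebra over `ℤ/pℤ`. -/
def AbsIrredMod {n p : ℕ} (G : Subgroup (SL n (ZMod p))) : Prop :=
  Algebra.adjoin (ZMod p)
    ((fun g : SL n (ZMod p) => (g : Matrix (Fin n) (Fin n) (ZMod p))) '' (G : Set _)) = ⊤

/-- Irreducibility of the natural action of a subgroup of `SL(n,R)` on `R^n`. -/
def IrreducibleSub (R : Type*) [CommRing R] {n : ℕ} (G : Subgroup (SL n R)) : Prop :=
  ∀ W : Submodule R (Fin n → R),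
    (∀ g ∈ G, W.map (Matrix.toLin' (g : Matrix (Fin n) (Fin n) R)) ≤ W) → W = ⊥ ∨ W = ⊤

/-- Imprimitivity: a nontrivial direct-sum decomposition whose summands are permuted by `G`. -/
def ImprimitiveSub (R : Type*) [CommRing R] {n : ℕ} (G : Subgroup (SL n R)) : Prop :=
  ∃ m : ℕ, 2 ≤ m ∧ ∃ W : Fin m → Submodule R (Fin n → R),
    (∀ i, W i ≠ ⊥) ∧ DirectSum.IsInternal W ∧
    ∀ g ∈ G, ∀ i, ∃ j, (W i).map (Matrix.toLin' (g : Matrix (Fin n) (Fin n) R)) = W j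

/-- Primitivity: irreducible and not imprimitive. -/
def PrimitiveSub (R : Type*) [CommRing R] {n : ℕ} (G : Subgroup (SL n R)) : Prop :=
  IrreducibleSub R G ∧ ¬ ImprimitiveSub R G

/-- Monomiality: a direct sum of `n` one-dimensional subspaces permuted by `G`. -/
def MonomialSub (R : Type*) [CommRing R] {n : ℕ} (G : Subgroup (SL n R)) : Prop :=
  ∃ L : Fin n → Submodule R (Fin n → R),
    (∀ i, Module.finrank R (L i) = 1) ∧ DirectSum.IsInternal L ∧
    ∀ g ∈ G, ∀ i, ∃ j, (L i).map (Matrix.toLin' (g : Matrix (Fin n) (Fin n) R)) = L j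

/-- Irreducibility of a subgroup of `SL(n,ℤ)` acting on `ℚ^n`. -/
def IrreducibleQ {n : ℕ} (H : Subgroup (SL n ℤ)) : Prop :=
  ∀ W : Submodule ℚ (Fin n → ℚ),
    (∀ g ∈ H, W.map (Matrix.toLin' (matQ g)) ≤ W) → W = ⊥ ∨ W = ⊤

/-- Imprimitivity of a subgroup of `SL(n,ℤ)` acting on `ℚ^n`. -/
def ImprimitiveQ {n : ℕ} (H : Subgroup (SL n ℤ)) : Prop :=
  ∃ m : ℕ, 2 ≤ m ∧ ∃ W : Fin m → Submodule ℚ (Fin n → ℚ),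
    (∀ i, W i ≠ ⊥) ∧ DirectSum.IsInternal W ∧
    ∀ g ∈ H, ∀ i, ∃ j, (W i).map (Matrix.toLin' (matQ g)) = W j

/-- Primitivity of a subgroup of `SL(n,ℤ)` acting on `ℚ^n`. -/
def PrimitiveQ {n : ℕ} (H : Subgroup (SL n ℤ)) : Prop :=
  IrreducibleQ H ∧ ¬ ImprimitiveQ H

/-- A group is solvable-by-finite if it has a solvable subgroup of finite index. -/
def SolvableByFinite (G : Type*) [Group G] : Prop :=
  ∃ K : Subgroup G, IsSolvable K ∧ K.FiniteIndex

/-- A subgroup of `SL(n,ℤ)` is an isometry group if it preserves a nondegenerate bilinear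
form on `ℚ^n`. -/
def IsometryGroupQ {n : ℕ} (H : Subgroup (SL n ℤ)) : Prop :=
  ∃ Φ : Matrix (Fin n) (Fin n) ℚ, IsUnit Φ ∧ ∀ h ∈ H, matQ h * Φ * (matQ h)ᵀ = Φ

set_option linter.all false


theorem aux_transv_mul {n : ℕ} {F : Type*} [Field F] (i j : Fin n) (c : F)
    (M : Matrix (Fin n) (Fin n) F) (k l : Fin n) :
    (Matrix.transvection i j c * M) k l = M k l + if k = i then c * M j l else 0 := by
  by_cases h : k = i
  · subst h; simp [Matrix.transvection_mul_apply_same]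
  · simp [Matrix.transvection_mul_apply_of_ne _ _ _ _ h, h]

theorem aux_diag2 {n : ℕ} {F : Type*} [Field F] (i j : Fin n) (hij : i ≠ j) (a : F) (ha : a ≠ 0) :
    Matrix.transvection i j a * (Matrix.transvection j i (-a⁻¹) * (Matrix.transvection i j a *
      (Matrix.transvection i j (-1) * (Matrix.transvection j i 1 * (Matrix.transvection i j (-1) * 1)))))
    = Matrix.diagonal (fun k => if k = i then a else if k = j then a⁻¹ else 1) := by
  ext k l
  simp only [aux_transv_mul, hij, hij.symm, if_true, if_false]
  by_cases hki : k = i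
  · subst hki
    by_cases hl : l = k
    · subst hl; simp [hij.symm, hij, Matrix.one_apply]
      field_simp
      simp
    · by_cases hl2 : l = j
      · subst hl2; simp [hij, hij.symm, Matrix.one_apply, Matrix.diagonal_apply]
        try field_simp
        try ring
      · simp [hij, Matrix.one_apply, Matrix.diagonal_apply, Ne.symm hl, Ne.symm hl2]
  · by_cases hkj : k = j
    · subst hkj
      by_cases hl : l = k
      · subst hl; simp [hij.symm, hij, Matrix.one_apply]
        try field_simp
        try ring
      · by_cases hl2 : l = i
        · subst hl2; simp [hij, hij.symm, Matrix.one_apply, Matrix.diagonal_apply]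
          try field_simp
          try ring
        · simp [hij.symm, Matrix.one_apply, Matrix.diagonal_apply, Ne.symm hl, Ne.symm hl2]
    · simp [hki, hkj, Matrix.one_apply, Matrix.diagonal_apply]

theorem aux_SL_top {n : ℕ} {F : Type*} [Field F] (K : Subgroup (Matrix.SpecialLinearGroup (Fin n) F))
    (hK : ∀ (i j : Fin n) (hij : i ≠ j) (c : F), Matrix.SpecialLinearGroup.transvection hij c ∈ K) :
    K = ⊤ := by
  classical
  -- set of matrices coming from K
  let S : Submonoid (Matrix (Fin n) (Fin n) F) := K.toSubmonoid.map
    ({ toFun := fun g => (g : Matrix (Fin n) (Fin n) F), map_one' := by simp, map_mul' := by simp } : 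
        Matrix.SpecialLinearGroup (Fin n) F →* Matrix (Fin n) (Fin n) F)
  have hS : ∀ g : Matrix.SpecialLinearGroup (Fin n) F, (g : Matrix (Fin n) (Fin n) F) ∈ S → g ∈ K := by
    rintro g ⟨g', hg', h⟩
    have : g' = g := by ext1; exact congrFun (congrFun h _) _
    exact this ▸ hg'
  have hT : ∀ (i j : Fin n) (hij : i ≠ j) (c : F), Matrix.transvection i j c ∈ S :=
    fun i j hij c => ⟨_, hK i j hij c, rfl⟩
  have hD2 : ∀ (i j : Fin n) (hij : i ≠ j) (a : F), a ≠ 0 →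
      Matrix.diagonal (fun k => if k = i then a else if k = j then a⁻¹ else 1) ∈ S := by
    intro i j hij a ha
    rw [← aux_diag2 i j hij a ha]
    refine S.mul_mem (hT _ _ hij _) (S.mul_mem (hT _ _ hij.symm _) (S.mul_mem (hT _ _ hij _)
      (S.mul_mem (hT _ _ hij _) (S.mul_mem (hT _ _ hij.symm _) (S.mul_mem (hT _ _ hij _) S.one_mem)))))
  have hD : ∀ D : Fin n → F, (∏ i, D i) = 1 → Matrix.diagonal D ∈ S := by
    intro D hD
    rcases Nat.eq_zero_or_pos n with hn | hn
    · subst hn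
      have : Matrix.diagonal D = 1 := Subsingleton.elim _ _
      rw [this]; exact S.one_mem
    let i0 : Fin n := ⟨0, hn⟩
    have hne : ∀ i, D i ≠ 0 := by
      intro i hi
      rw [Finset.prod_eq_zero (Finset.mem_univ i) hi] at hD
      exact zero_ne_one hD
    have key : ∀ s : Finset (Fin n), i0 ∉ s →
        Matrix.diagonal (fun k => if k ∈ s then D k else if k = i0 then (∏ i ∈ s, D i)⁻¹ else 1) ∈ S := by
      intro s
      induction s using Finset.induction_on with
      | empty => 
        intro _
        convert S.one_mem using 1
        simp
      | insert a s ha ih =>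
        intro h0
        simp only [Finset.mem_insert, not_or] at h0
        have := S.mul_mem (hD2 a i0 (Ne.symm h0.1) (D a) (hne a)) (ih h0.2)
        rw [Matrix.diagonal_mul_diagonal] at this
        convert this using 2
        ext k
        by_cases hk : k = a
        · subst hk; simp [ha, Ne.symm h0.1]
        · by_cases hk0 : k = i0
          · subst hk0
            simp [h0, Finset.prod_insert ha, mul_comm]
          · simp [hk, hk0]
    have := key (Finset.univ.erase i0) (by simp)
    convert this using 2
    ext k
    by_cases hk : k = i0
    · subst hk
      simp
      rw [← Finset.mul_prod_erase _ _ (Finset.mem_univ i0)] at hD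
      exact eq_inv_of_mul_eq_one_left hD
    · simp [hk]
  rw [eq_top_iff]
  intro g _
  apply hS
  obtain ⟨L, L', D, h⟩ := Matrix.Pivot.exists_list_transvec_mul_diagonal_mul_list_transvec
    (g : Matrix (Fin n) (Fin n) F)
  have hL : ∀ L : List (Matrix.TransvectionStruct (Fin n) F),
      (L.map Matrix.TransvectionStruct.toMatrix).prod ∈ S := by
    intro L
    apply S.list_prod_mem
    intro x hx
    obtain ⟨t, _, rfl⟩ := List.mem_map.1 hx
    exact hT t.i t.j t.hij t.c
  rw [h]
  refine S.mul_mem (S.mul_mem (hL L) (hD D ?_)) (hL L')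
  have := congrArg Matrix.det h
  simpa using this.symm

theorem aux_index {G : Type*} [Group G] [Finite G] {p : ℕ} (hp : p.Prime) (K : Subgroup G)
    (hK : Nat.card G < p * Nat.card K) (g : G) (hg : g ^ p = 1) : g ∈ K := by
  classical
  have hlt : Nat.card (G ⧸ K) < p := by
    have := K.card_eq_card_quotient_mul_card_subgroup
    rw [this] at hK
    exact lt_of_mul_lt_mul_right hK (Nat.zero_le _)
  have : Fintype (G ⧸ K) := Fintype.ofFinite _
  let σ := MulAction.toPermHom G (G ⧸ K) g
  have h1 : orderOf σ ∣ p := by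
    apply orderOf_dvd_of_pow_eq_one
    rw [← map_pow, hg, map_one]
  have h2 : orderOf σ ∣ (Fintype.card (G ⧸ K)).factorial := by
    rw [← Fintype.card_perm]; exact orderOf_dvd_card
  have hσ : σ = 1 := by
    rcases (Nat.dvd_prime hp).1 h1 with h | h
    · exact orderOf_eq_one_iff.1 h
    · rw [h] at h2
      have := (hp.dvd_factorial).1 h2
      rw [← Nat.card_eq_fintype_card] at this
      omega
  have h3 : σ (QuotientGroup.mk 1) = QuotientGroup.mk 1 := by rw [hσ]; rfl
  have h4 : (QuotientGroup.mk (g * 1) : G ⧸ K) = QuotientGroup.mk 1 := h3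
  rw [mul_one] at h4
  have := QuotientGroup.eq.1 h4
  simpa using this

theorem aux_big_top {n p : ℕ} [Fact p.Prime] (K : Subgroup (Matrix.SpecialLinearGroup (Fin n) (ZMod p)))
    (hK : Nat.card (Matrix.SpecialLinearGroup (Fin n) (ZMod p)) < p * Nat.card K) : K = ⊤ := by
  apply aux_SL_top
  intro i j hij c
  apply aux_index (Fact.out : p.Prime) K hK
  have : ∀ m : ℕ, (Matrix.SpecialLinearGroup.transvection hij c) ^ m =
      Matrix.SpecialLinearGroup.transvection hij (m * c) := by
    intro m
    induction m with
    | zero => simp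
    | succ m ih =>
      rw [pow_succ, ih]
      apply Subtype.ext
      have := Matrix.transvection_mul_transvection_same i j hij (m * c) c
      refine this.trans ?_
      change _ = Matrix.transvection i j _
      congr 1
      push_cast; ring
  rw [this]
  simp

theorem aux_card_SL {n p : ℕ} [Fact p.Prime] (hn : 0 < n) :
    Nat.card (Matrix.SpecialLinearGroup (Fin n) (ZMod p)) * (p - 1) ≤ p ^ (n * n) := by
  classical
  have h1 : Nat.card (ZMod p)ˣ = p - 1 := by
    rw [Nat.card_eq_fintype_card, ZMod.card_units]
  have h2 : Nat.card (Matrix (Fin n) (Fin n) (ZMod p)) = p ^ (n * n) := by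
    unfold Matrix
    rw [Nat.card_fun, Nat.card_fun]
    simp [pow_mul]
  rw [← h1, ← h2, ← Nat.card_prod]
  let i0 : Fin n := ⟨0, hn⟩
  let D : (ZMod p)ˣ → Matrix (Fin n) (Fin n) (ZMod p) := fun c =>
    Matrix.diagonal (fun k => if k = i0 then (c : ZMod p) else 1)
  have hdet : ∀ c, (D c).det = c := by
    intro c
    simp [D, Matrix.det_diagonal]
  refine Nat.card_le_card_of_injective
    (fun x : Matrix.SpecialLinearGroup (Fin n) (ZMod p) × (ZMod p)ˣ => D x.2 * x.1.1) ?_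
  rintro ⟨A, c⟩ ⟨B, e⟩ h
  simp only at h
  have h3 := congrArg Matrix.det h
  rw [Matrix.det_mul, Matrix.det_mul, A.2, B.2, hdet, hdet, mul_one, mul_one] at h3
  have h4 : c = e := Units.ext h3
  subst h4
  have hu : IsUnit (D c) := by
    rw [Matrix.isUnit_iff_isUnit_det, hdet]; exact c.isUnit
  have := hu.mul_left_cancel h
  exact Prod.ext (Subtype.ext this) rfl


noncomputable def auxB (p k : ℕ) : Polynomial (ZMod p) :=
  Polynomial.C (((k.factorial : ℕ) : ZMod p)⁻¹) * descPochhammer (ZMod p) k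

noncomputable def auxLog {n p : ℕ} (N : Matrix (Fin n) (Fin n) (ZMod p)) :
    Matrix (Fin n) (Fin n) (ZMod p) :=
  ∑ k ∈ Finset.range n, (auxB p k).coeff 1 • N ^ k

theorem auxB_eval {p k : ℕ} [Fact p.Prime] (hk : k < p) (t : ℕ) :
    (auxB p k).eval (t : ZMod p) = (t.choose k : ℕ) := by
  have h : ((k.factorial : ℕ) : ZMod p) ≠ 0 := by
    intro h
    rw [ZMod.natCast_eq_zero_iff] at h
    have := ((Fact.out : p.Prime).dvd_factorial).1 h
    omega
  unfold auxB
  rw [Polynomial.eval_mul, Polynomial.eval_C, descPochhammer_eval_eq_descFactorial,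
    Nat.descFactorial_eq_factorial_mul_choose]
  push_cast
  rw [← mul_assoc, inv_mul_cancel₀ h, one_mul]

theorem auxB_natDegree {p k : ℕ} [Fact p.Prime] : (auxB p k).natDegree ≤ k := by
  unfold auxB
  refine (Polynomial.natDegree_C_mul_le _ _).trans ?_
  rw [descPochhammer_natDegree]

theorem auxB_coeff_zero {p k : ℕ} [Fact p.Prime] (hk : k < p) :
    (auxB p k).coeff 0 = if k = 0 then 1 else 0 := by
  rw [Polynomial.coeff_zero_eq_eval_zero]
  have := auxB_eval hk 0
  simp only [Nat.cast_zero] at this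
  rw [this]
  cases k <;> simp

theorem aux_aeval_mod {p d : ℕ} [Fact p.Prime] (b : Polynomial (ZMod p)) (i : Fin d) :
    Ideal.Quotient.mk (MvPolynomial.idealOfVars (Fin d) (ZMod p) ^ 2) (Polynomial.aeval (MvPolynomial.X i : MvPolynomial (Fin d) (ZMod p)) b)
     = Ideal.Quotient.mk _ (MvPolynomial.C (b.coeff 0)) + Ideal.Quotient.mk _ (MvPolynomial.X i) * Ideal.Quotient.mk _ (MvPolynomial.C (b.coeff 1)) := by
  have h1 : b = (b.divX.divX * Polynomial.X + Polynomial.C (b.coeff 1)) * Polynomial.X + Polynomial.C (b.coeff 0) := by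
    conv_lhs => rw [← Polynomial.divX_mul_X_add b, ← Polynomial.divX_mul_X_add b.divX]
    simp
  rw [← map_mul, ← map_add, Ideal.Quotient.eq]
  rw [congrArg (Polynomial.aeval (MvPolynomial.X i : MvPolynomial (Fin d) (ZMod p))) h1]
  have h2 : (MvPolynomial.X i : MvPolynomial (Fin d) (ZMod p)) ∈ MvPolynomial.idealOfVars (Fin d) (ZMod p) :=
    Ideal.subset_span ⟨i, rfl⟩
  have h3 := Ideal.mul_mem_left _ (Polynomial.aeval (MvPolynomial.X i : MvPolynomial (Fin d) (ZMod p)) b.divX.divX) (Ideal.pow_mem_pow h2 2)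
  convert h3 using 1
  simp [MvPolynomial.algebraMap_eq]
  ring

theorem aux_onepar {n p d : ℕ} [Fact p.Prime] (hnp : n ≤ p)
    (N : Matrix (Fin n) (Fin n) (ZMod p)) (hN : N ^ n = 0) (hn : 0 < n) (i : Fin d) :
    ∃ B : Matrix (Fin n) (Fin n) (MvPolynomial (Fin d) (ZMod p)),
      (∀ a b, (B a b).totalDegree ≤ n) ∧
      (∀ x : Fin d → ZMod p, (MvPolynomial.eval x).mapMatrix B = (1 + N) ^ (x i).val) ∧
      (Ideal.Quotient.mk (MvPolynomial.idealOfVars (Fin d) (ZMod p) ^ 2)).mapMatrix B =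
        1 + (Ideal.Quotient.mk (MvPolynomial.idealOfVars (Fin d) (ZMod p) ^ 2) (MvPolynomial.X i)) •
          ((Ideal.Quotient.mk (MvPolynomial.idealOfVars (Fin d) (ZMod p) ^ 2)).comp MvPolynomial.C).mapMatrix (auxLog N) := by
  refine ⟨∑ k ∈ Finset.range n, (Polynomial.aeval (MvPolynomial.X i : MvPolynomial (Fin d) (ZMod p)) (auxB p k)) •
    (MvPolynomial.C : ZMod p →+* MvPolynomial (Fin d) (ZMod p)).mapMatrix (N ^ k), ?_, ?_, ?_⟩
  · intro a b
    rw [Matrix.sum_apply]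
    refine MvPolynomial.totalDegree_finsetSum_le fun k hk => ?_
    rw [Finset.mem_range] at hk
    rw [Matrix.smul_apply, smul_eq_mul]
    refine (MvPolynomial.totalDegree_mul _ _).trans ?_
    have : ((MvPolynomial.C : ZMod p →+* MvPolynomial (Fin d) (ZMod p)).mapMatrix (N ^ k) a b).totalDegree = 0 := by
      rw [RingHom.mapMatrix_apply, Matrix.map_apply, MvPolynomial.totalDegree_C]
    rw [this, add_zero, Polynomial.aeval_eq_sum_range]
    refine MvPolynomial.totalDegree_finsetSum_le fun l hl => ?_
    rw [Finset.mem_range] at hl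
    refine (MvPolynomial.totalDegree_smul_le _ _).trans ?_
    rw [MvPolynomial.totalDegree_X_pow]
    have := auxB_natDegree (p := p) (k := k)
    omega
  · intro x
    have hx : x i = (((x i).val : ℕ) : ZMod p) := (ZMod.natCast_zmod_val _).symm
    have hc : Commute N 1 := Commute.one_right N
    rw [add_comm 1 N, hc.add_pow, map_sum]
    have e1 : ∀ k ∈ Finset.range n, (MvPolynomial.eval x).mapMatrix ((Polynomial.aeval (MvPolynomial.X i : MvPolynomial (Fin d) (ZMod p)) (auxB p k)) •
    (MvPolynomial.C : ZMod p →+* MvPolynomial (Fin d) (ZMod p)).mapMatrix (N ^ k)) = N ^ k * (((x i).val.choose k : ℕ) : Matrix (Fin n) (Fin n) (ZMod p)) := by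
      intro k hk
      rw [Finset.mem_range] at hk
      have hev : MvPolynomial.eval x (Polynomial.aeval (MvPolynomial.X i : MvPolynomial (Fin d) (ZMod p)) (auxB p k)) = ((x i).val.choose k : ℕ) := by
        rw [← auxB_eval (lt_of_lt_of_le hk hnp), ← hx]
        have := Polynomial.aeval_algHom_apply (MvPolynomial.aeval x : MvPolynomial (Fin d) (ZMod p) →ₐ[ZMod p] ZMod p) (MvPolynomial.X i) (auxB p k)
        rw [MvPolynomial.aeval_X] at this
        rw [← Polynomial.coe_aeval_eq_eval]
        simpa [MvPolynomial.aeval_eq_eval] using this.symm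
      ext a b
      rw [← nsmul_eq_mul']
      simp [hev]
    rw [Finset.sum_congr rfl e1]
    simp only [one_pow, mul_one]
    have e2 : ∀ k, n ≤ k → N ^ k * (((x i).val.choose k : ℕ) : Matrix (Fin n) (Fin n) (ZMod p)) = 0 := by
      intro k hk
      rw [pow_eq_zero_of_le hk hN, zero_mul]
    have e3 : ∀ k, (x i).val + 1 ≤ k → N ^ k * (((x i).val.choose k : ℕ) : Matrix (Fin n) (Fin n) (ZMod p)) = 0 := by
      intro k hk
      rw [Nat.choose_eq_zero_of_lt (by omega)]; simp
    rcases le_total n ((x i).val + 1) with h | h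
    · apply Finset.sum_subset (Finset.range_mono h)
      intro k _ hk
      exact e2 k (by simpa using hk)
    · symm
      apply Finset.sum_subset (Finset.range_mono h)
      intro k _ hk
      exact e3 k (by simpa using hk)
  · ext a b
    simp only [RingHom.mapMatrix_apply, Matrix.map_apply, Matrix.sum_apply, Matrix.smul_apply, smul_eq_mul,
      map_sum, map_mul, aux_aeval_mod, Matrix.add_apply, auxLog, RingHom.comp_apply, Finset.mul_sum, add_mul]
    rw [Finset.sum_add_distrib]
    congr 1
    · rw [Finset.sum_eq_single 0]
      · rw [auxB_coeff_zero (by omega)]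
        by_cases hab : a = b <;> simp [Matrix.one_apply, hab]
      · intro k hk hk0
        rw [Finset.mem_range] at hk
        rw [auxB_coeff_zero (by omega)]
        simp [hk0]
      · simp [hn.ne']
    · exact Finset.sum_congr rfl fun k _ => by ring

theorem auxLog_spec {n p : ℕ} [Fact p.Prime] (hnp : n ≤ p) (hn : 2 ≤ n)
    (N : Matrix (Fin n) (Fin n) (ZMod p)) (hN : N ^ n = 0) (hN0 : N ≠ 0) (c : ZMod p) :
    auxLog N ≠ Matrix.scalar (Fin n) c := by
  have h0 : (auxB p 0).coeff 1 = 0 := by simp [auxB, Polynomial.coeff_one]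
  have h1 : (auxB p 1).coeff 1 = 1 := by simp [auxB]
  obtain ⟨m, rfl⟩ : ∃ m, n = m + 2 := ⟨n - 2, by omega⟩
  set M : Matrix (Fin (m+2)) (Fin (m+2)) (ZMod p) := ∑ k ∈ Finset.range m, (auxB p (k + 2)).coeff 1 • N ^ k with hM
  have hcomm : Commute N M := by
    rw [hM]
    refine Commute.sum_right _ _ _ fun k _ => ?_
    exact ((Commute.refl N).pow_right k).smul_right _
  have hL : auxLog N = N * (1 + N * M) := by
    unfold auxLog
    rw [Finset.sum_range_succ', Finset.sum_range_succ']
    rw [zero_add, h0, h1, hM, mul_add, mul_one, ← mul_assoc, Finset.mul_sum]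
    simp only [zero_smul, add_zero, one_smul, pow_one]
    refine (add_comm _ _).trans ?_
    congr 1
    refine Finset.sum_congr rfl fun k _ => ?_
    rw [mul_smul_comm]
    congr 1
    rw [← pow_two, ← pow_add]
    congr 1
    omega
  have hnil : IsNilpotent N := ⟨_, hN⟩
  have hu : IsUnit (1 + N * M) := by
    have : IsNilpotent (N * M) := hcomm.isNilpotent_mul_right hnil
    exact this.isUnit_one_add
  have hLnil : IsNilpotent (auxLog N) := by
    rw [hL]
    refine Commute.isNilpotent_mul_right ?_ hnil
    exact (Commute.one_right N).add_right ((Commute.refl N).mul_right hcomm)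
  intro h
  have hc : c = 0 := by
    obtain ⟨k, hk⟩ := hLnil
    rw [h, ← map_pow] at hk
    have := congrFun (congrFun hk 0) 0
    simp at this
    exact this.1
  rw [hc, map_zero, hL] at h
  exact hN0 ((hu.mul_left_eq_zero).1 h)


theorem aux_monomial {d : ℕ} {F : Type*} [Field F] (f : Fin d → MvPolynomial (Fin d) F)
    (hf : ∀ j, f j - MvPolynomial.X j ∈ MvPolynomial.idealOfVars (Fin d) F ^ 2) (s : Fin d →₀ ℕ) :
    MvPolynomial.aeval f (MvPolynomial.monomial s (1 : F)) - MvPolynomial.monomial s 1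
      ∈ MvPolynomial.idealOfVars (Fin d) F ^ (s.degree + 1) := by
  have hmon : ∀ s : Fin d →₀ ℕ, MvPolynomial.monomial s (1 : F) ∈
      MvPolynomial.idealOfVars (Fin d) F ^ s.degree := by
    intro s
    rw [MvPolynomial.monomial_mem_pow_idealOfVars_iff _ _ one_ne_zero]
  have hmul : ∀ s t : Fin d →₀ ℕ,
    MvPolynomial.aeval f (MvPolynomial.monomial s (1 : F)) - MvPolynomial.monomial s 1
      ∈ MvPolynomial.idealOfVars (Fin d) F ^ (s.degree + 1) → 
    MvPolynomial.aeval f (MvPolynomial.monomial t (1 : F)) - MvPolynomial.monomial t 1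
      ∈ MvPolynomial.idealOfVars (Fin d) F ^ (t.degree + 1) →
    MvPolynomial.aeval f (MvPolynomial.monomial (s + t) (1 : F)) - MvPolynomial.monomial (s + t) 1
      ∈ MvPolynomial.idealOfVars (Fin d) F ^ ((s + t).degree + 1) := by
    intro s t hs ht
    have e : MvPolynomial.monomial (s + t) (1 : F) = MvPolynomial.monomial s 1 * MvPolynomial.monomial t 1 := by
      simp
    rw [e, map_mul]
    have e2 : ∀ a b a' b' : MvPolynomial (Fin d) F, a * b - a' * b' = (a - a') * (b - b') + (a - a') * b' + a' * (b - b') := by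
      intros; ring
    rw [e2]
    have hd : (s + t).degree = s.degree + t.degree := by simp
    rw [hd]
    refine Ideal.add_mem _ (Ideal.add_mem _ ?_ ?_) ?_
    · have := Ideal.mul_mem_mul hs ht
      rw [← pow_add] at this
      exact Ideal.pow_le_pow_right (by omega) this
    · have := Ideal.mul_mem_mul hs (hmon t)
      rw [← pow_add] at this
      exact Ideal.pow_le_pow_right (by omega) this
    · have := Ideal.mul_mem_mul (hmon s) ht
      rw [← pow_add] at this
      exact Ideal.pow_le_pow_right (by omega) this
  induction s using Finsupp.induction_linear with
  | zero => simp
  | add s t hs ht => exact hmul s t hs ht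
  | single i k =>
    induction k with
    | zero => simp
    | succ k ih =>
      rw [Finsupp.single_add]
      apply hmul _ _ ih
      have : MvPolynomial.monomial (Finsupp.single i 1) (1 : F) = MvPolynomial.X i := rfl
      rw [this, MvPolynomial.aeval_X]
      simpa using hf i

theorem aux_subst {d : ℕ} {F : Type*} [Field F] (f : Fin d → MvPolynomial (Fin d) F)
    (hf : ∀ j, f j - MvPolynomial.X j ∈ MvPolynomial.idealOfVars (Fin d) F ^ 2)
    (Q : MvPolynomial (Fin d) F) (hQ : MvPolynomial.aeval f Q = 0) : Q = 0 := by
  have key : ∀ e : ℕ, Q ∈ MvPolynomial.idealOfVars (Fin d) F ^ e := by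
    intro e
    induction e with
    | zero => simp
    | succ e ih =>
      have h : MvPolynomial.aeval f Q - Q ∈ MvPolynomial.idealOfVars (Fin d) F ^ (e + 1) := by
        have hQ' := Q.as_sum
        have e1 : MvPolynomial.aeval f Q - Q = ∑ v ∈ Q.support, 
          MvPolynomial.C (Q.coeff v) * (MvPolynomial.aeval f (MvPolynomial.monomial v (1 : F)) - MvPolynomial.monomial v 1) := by
          conv_lhs => rw [hQ']
          rw [map_sum, ← Finset.sum_sub_distrib]
          refine Finset.sum_congr rfl fun v _ => ?_
          have : MvPolynomial.monomial v (Q.coeff v) = MvPolynomial.C (Q.coeff v) * MvPolynomial.monomial v 1 := by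
            rw [MvPolynomial.C_mul_monomial, mul_one]
          rw [this, map_mul, mul_sub]
          simp [MvPolynomial.algebraMap_eq]
        rw [e1]
        refine Ideal.sum_mem _ fun v hv => Ideal.mul_mem_left _ _ ?_
        have h1 := aux_monomial f hf v
        have h2 := (MvPolynomial.mem_pow_idealOfVars_iff _ _).1 ih v hv
        exact Ideal.pow_le_pow_right (by omega) h1
      rw [hQ, zero_sub] at h
      exact (Ideal.neg_mem_iff _).1 h
  by_contra hne
  obtain ⟨v, hv⟩ := MvPolynomial.support_nonempty.2 hne
  have := (MvPolynomial.mem_pow_idealOfVars_iff _ _).1 (key (v.degree + 1)) v hv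
  omega

theorem aux_count {p d D m : ℕ} [Fact p.Prime] (f : Fin d → MvPolynomial (Fin d) (ZMod p))
    (c : Fin d → ZMod p)
    (hf : ∀ j, f j - MvPolynomial.C (c j) - MvPolynomial.X j ∈ MvPolynomial.idealOfVars (Fin d) (ZMod p) ^ 2)
    (hD : ∀ j, (f j).totalDegree ≤ D) (hm : d * m * D < p) :
    (m + 1) ^ d ≤ Nat.card (Set.range (fun (x : Fin d → ZMod p) (j : Fin d) => MvPolynomial.eval x (f j))) := by
  classical
  set S := Set.range (fun (x : Fin d → ZMod p) (j : Fin d) => MvPolynomial.eval x (f j)) with hS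
  let fs : (Fin d → Fin (m + 1)) → (Fin d →₀ ℕ) := fun a => Finsupp.equivFunOnFinite.symm (fun i => (a i : ℕ))
  have hfs : Function.Injective fs := by
    intro a b h
    have := Finsupp.equivFunOnFinite.symm.injective h
    funext i
    exact Fin.ext (congrFun this i)
  let g : Fin d → MvPolynomial (Fin d) (ZMod p) := fun j => f j - MvPolynomial.C (c j)
  let Φ : ((Fin d → Fin (m + 1)) → ZMod p) →ₗ[ZMod p] (S → ZMod p) :=
    { toFun := fun a s => ∑ i, a i * ∏ j, (s.1 j - c j) ^ (i j : ℕ)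
      map_add' := by
        intro a b; funext s; simp [add_mul, Finset.sum_add_distrib]
      map_smul' := by
        intro r a; funext s; simp [mul_assoc, Finset.mul_sum] }
  have hinj : Function.Injective Φ := by
    rw [← LinearMap.ker_eq_bot, LinearMap.ker_eq_bot']
    intro a ha
    let Q : MvPolynomial (Fin d) (ZMod p) := ∑ i, MvPolynomial.monomial (fs i) (a i)
    have hgQ : MvPolynomial.aeval g Q = ∑ i, MvPolynomial.C (a i) * ∏ j, (g j) ^ (i j : ℕ) := by
      simp only [Q, map_sum]
      refine Finset.sum_congr rfl fun i _ => ?_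
      rw [MvPolynomial.aeval_monomial, MvPolynomial.algebraMap_eq]
      congr 1
      rw [Finsupp.prod_fintype _ _ (by simp)]
      rfl
    have hz : MvPolynomial.aeval g Q = 0 := by
      apply MvPolynomial.eq_zero_of_eval_zero_at_prod_finset _ (fun _ => (Finset.univ : Finset (ZMod p)))
      · intro i
        rw [Finset.card_univ, ZMod.card]
        refine lt_of_le_of_lt (MvPolynomial.degreeOf_le_totalDegree _ _) (lt_of_le_of_lt ?_ hm)
        rw [hgQ]
        refine MvPolynomial.totalDegree_finsetSum_le fun a' _ => ?_
        refine (MvPolynomial.totalDegree_mul _ _).trans ?_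
        rw [MvPolynomial.totalDegree_C, zero_add]
        refine (MvPolynomial.totalDegree_finset_prod _ _).trans ?_
        refine (Finset.sum_le_card_nsmul _ _ (m * D) ?_).trans (by simp [mul_assoc])
        intro j _
        refine (MvPolynomial.totalDegree_pow _ _).trans ?_
        refine Nat.mul_le_mul (by have := (a' j).2; omega) ?_
        refine (MvPolynomial.totalDegree_sub_C_le _ _).trans (hD j)
      · intro x _
        have := congrFun ha ⟨_, ⟨x, rfl⟩⟩
        rw [hgQ]
        simpa [Φ, g] using this
    have hQ := aux_subst g hf Q hz
    funext i
    have := congrArg (MvPolynomial.coeff (fs i)) hQ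
    simp only [Q, MvPolynomial.coeff_sum, MvPolynomial.coeff_monomial, hfs.eq_iff] at this
    simpa using this
  have h1 := LinearMap.finrank_le_finrank_of_injective hinj
  have : Fintype S := Fintype.ofFinite S
  rw [Module.finrank_fintype_fun_eq_card, Module.finrank_fintype_fun_eq_card] at h1
  rw [Nat.card_eq_fintype_card]
  simpa using h1


/-- Every conjugation-invariant subspace of matrices containing a nonscalar matrix
contains all trace-zero matrices. -/
def AdIrr {n : ℕ} {F : Type*} [Field F] (G : Subgroup (Matrix.SpecialLinearGroup (Fin n) F)) : Prop :=
  ∀ W : Submodule F (Matrix (Fin n) (Fin n) F),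
    (∀ g ∈ G, ∀ X ∈ W, (g : Matrix (Fin n) (Fin n) F) * X * ((g⁻¹ : Matrix.SpecialLinearGroup (Fin n) F) : Matrix (Fin n) (Fin n) F) ∈ W) →
    ∀ X ∈ W, (∀ c, X ≠ Matrix.scalar (Fin n) c) → ∀ i j : Fin n, i ≠ j →
      Matrix.single i j 1 ∈ W ∧ Matrix.single i i 1 - Matrix.single j j 1 ∈ W

theorem aux_nilp {n p : ℕ} [Fact p.Prime] (u : Matrix (Fin n) (Fin n) (ZMod p)) (hu : u ^ p = 1) :
    (u - 1) ^ n = 0 := by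
  rcases Nat.eq_zero_or_pos n with h | h
  · subst h; exact Subsingleton.elim _ _
  have : Nonempty (Fin n) := ⟨⟨0, h⟩⟩
  have h1 : IsNilpotent (u - 1) := by
    refine ⟨p, ?_⟩
    rw [sub_pow_char_of_commute p (Commute.one_right u), hu, one_pow, sub_self]
  have h2 := Matrix.isNilpotent_charpoly_sub_pow_of_isNilpotent h1
  have h3 := sub_eq_zero.1 h2.eq_zero
  have h4 := Matrix.aeval_self_charpoly (u - 1)
  rw [h3] at h4
  simpa using h4

theorem aux_conj_span {n : ℕ} {F : Type*} [Field F] (G : Subgroup (Matrix.SpecialLinearGroup (Fin n) F))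
    (L : Matrix (Fin n) (Fin n) F) :
    ∀ g ∈ G, ∀ X ∈ Submodule.span F {Y | ∃ g ∈ G, Y = (g : Matrix (Fin n) (Fin n) F) * L * ((g⁻¹ : Matrix.SpecialLinearGroup (Fin n) F) : Matrix (Fin n) (Fin n) F)},
      (g : Matrix (Fin n) (Fin n) F) * X * ((g⁻¹ : Matrix.SpecialLinearGroup (Fin n) F) : Matrix (Fin n) (Fin n) F) ∈
      Submodule.span F {Y | ∃ g ∈ G, Y = (g : Matrix (Fin n) (Fin n) F) * L * ((g⁻¹ : Matrix.SpecialLinearGroup (Fin n) F) : Matrix (Fin n) (Fin n) F)} := by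
  intro g hg X hX
  induction hX using Submodule.span_induction with
  | mem x hx =>
    obtain ⟨g', hg', rfl⟩ := hx
    refine Submodule.subset_span ⟨g * g', G.mul_mem hg hg', ?_⟩
    rw [_root_.mul_inv_rev, Matrix.SpecialLinearGroup.coe_mul, Matrix.SpecialLinearGroup.coe_mul]
    simp only [mul_assoc]
  | zero => simp
  | add x y _ _ hx hy => rw [mul_add, add_mul]; exact Submodule.add_mem _ hx hy
  | smul c x _ hx => rw [mul_smul_comm, smul_mul_assoc]; exact Submodule.smul_mem _ _ hx

theorem aux_finrank {n : ℕ} {F : Type*} [Field F] (hn : 0 < n) (W : Submodule F (Matrix (Fin n) (Fin n) F))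
    (h : ∀ i j : Fin n, i ≠ j → Matrix.single i j 1 ∈ W ∧ Matrix.single i i 1 - Matrix.single j j 1 ∈ W) :
    n * n - 1 ≤ Module.finrank F W := by
  let i0 : Fin n := ⟨0, hn⟩
  have htop : W ⊔ Submodule.span F {Matrix.single i0 i0 (1 : F)} = ⊤ := by
    rw [eq_top_iff]
    intro X _
    rw [Matrix.matrix_eq_sum_single X]
    refine Submodule.sum_mem _ fun i _ => Submodule.sum_mem _ fun j _ => ?_
    have e : Matrix.single i j (X i j) = X i j • Matrix.single i j (1 : F) := by
      rw [Matrix.smul_single, smul_eq_mul, mul_one]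
    rw [e]
    apply Submodule.smul_mem
    by_cases hij : i = j
    · subst hij
      have h0 : Matrix.single i0 i0 (1 : F) ∈ W ⊔ Submodule.span F {Matrix.single i0 i0 (1 : F)} :=
        Submodule.mem_sup_right (Submodule.mem_span_singleton_self _)
      by_cases hi : i = i0
      · subst hi; exact h0
      · have := Submodule.add_mem _ (Submodule.mem_sup_left (h i i0 hi).2) h0
        simpa using this
    · exact Submodule.mem_sup_left (h i j hij).1
  have h1 := Submodule.finrank_add_le_finrank_add_finrank W (Submodule.span F {Matrix.single i0 i0 (1 : F)})
  rw [htop, finrank_top, Module.finrank_matrix] at h1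
  have h2 := finrank_span_le_card (R := F) ({Matrix.single i0 i0 (1 : F)} : Set (Matrix (Fin n) (Fin n) F))
  simp at h2
  simp at h1
  omega

theorem aux_prodlist {n p d : ℕ} [Fact p.Prime]
    (A : Fin d → Matrix (Fin n) (Fin n) (MvPolynomial (Fin d) (ZMod p)))
    (L : Fin d → Matrix (Fin n) (Fin n) (ZMod p))
    (hdeg : ∀ i a b, (A i a b).totalDegree ≤ n)
    (hmod : ∀ i, (Ideal.Quotient.mk (MvPolynomial.idealOfVars (Fin d) (ZMod p) ^ 2)).mapMatrix (A i) =
        1 + (Ideal.Quotient.mk (MvPolynomial.idealOfVars (Fin d) (ZMod p) ^ 2) (MvPolynomial.X i)) •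
          ((Ideal.Quotient.mk (MvPolynomial.idealOfVars (Fin d) (ZMod p) ^ 2)).comp MvPolynomial.C).mapMatrix (L i))
    (l : List (Fin d)) :
    (∀ a b, ((l.map A).prod a b).totalDegree ≤ l.length * n) ∧
    (Ideal.Quotient.mk (MvPolynomial.idealOfVars (Fin d) (ZMod p) ^ 2)).mapMatrix (l.map A).prod =
        1 + (l.map fun i => (Ideal.Quotient.mk (MvPolynomial.idealOfVars (Fin d) (ZMod p) ^ 2) (MvPolynomial.X i)) •
          ((Ideal.Quotient.mk (MvPolynomial.idealOfVars (Fin d) (ZMod p) ^ 2)).comp MvPolynomial.C).mapMatrix (L i)).sum := by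
  induction l with
  | nil =>
    refine ⟨fun a b => ?_, by simp⟩
    by_cases h : a = b <;> simp [h, Matrix.one_apply]
  | cons i l ih =>
    refine ⟨fun a b => ?_, ?_⟩
    · rw [List.map_cons, List.prod_cons, Matrix.mul_apply]
      refine MvPolynomial.totalDegree_finsetSum_le fun k hk => ?_
      refine (MvPolynomial.totalDegree_mul _ _).trans ?_
      have := ih.1 k b
      have := hdeg i a k
      rw [List.length_cons, add_mul]; omega
    · rw [List.map_cons, List.prod_cons, map_mul, ih.2, hmod, List.map_cons, List.sum_cons, mul_add, mul_one, add_mul, one_mul]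
      have hz : ∀ (M : Matrix (Fin n) (Fin n) (MvPolynomial (Fin d) (ZMod p) ⧸ MvPolynomial.idealOfVars (Fin d) (ZMod p) ^ 2)),
          ((Ideal.Quotient.mk (MvPolynomial.idealOfVars (Fin d) (ZMod p) ^ 2) (MvPolynomial.X i)) • M) *
          (l.map fun i => (Ideal.Quotient.mk (MvPolynomial.idealOfVars (Fin d) (ZMod p) ^ 2) (MvPolynomial.X i)) •
          ((Ideal.Quotient.mk (MvPolynomial.idealOfVars (Fin d) (ZMod p) ^ 2)).comp MvPolynomial.C).mapMatrix (L i)).sum = 0 := by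
        intro M
        clear ih
        induction l with
        | nil => simp
        | cons j l ih' =>
          rw [List.map_cons, List.sum_cons, mul_add, ih', add_zero, smul_mul_smul_comm]
          have : (Ideal.Quotient.mk (MvPolynomial.idealOfVars (Fin d) (ZMod p) ^ 2) (MvPolynomial.X i)) *
            (Ideal.Quotient.mk (MvPolynomial.idealOfVars (Fin d) (ZMod p) ^ 2) (MvPolynomial.X j)) = 0 := by
            rw [← map_mul, Ideal.Quotient.eq_zero_iff_mem, pow_two]
            exact Ideal.mul_mem_mul (Ideal.subset_span ⟨i, rfl⟩) (Ideal.subset_span ⟨j, rfl⟩)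
          rw [this, zero_smul]
      rw [hz, add_zero, add_assoc]

theorem aux_unip {n p m : ℕ} [Fact p.Prime] (hnp : n ≤ p) (hn : 2 ≤ n)
    (G : Subgroup (Matrix.SpecialLinearGroup (Fin n) (ZMod p))) (hG : AdIrr G)
    (u : Matrix.SpecialLinearGroup (Fin n) (ZMod p)) (hu : u ∈ G) (hu1 : u ≠ 1) (hup : u ^ p = 1)
    (hm : (n * n - 1) * m * ((n * n - 1) * n) < p) :
    (m + 1) ^ (n * n - 1) ≤ Nat.card G := by
  classical
  set d := n * n - 1 with hd
  set N : Matrix (Fin n) (Fin n) (ZMod p) := (u : Matrix (Fin n) (Fin n) (ZMod p)) - 1 with hNdef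
  have hup' : (u : Matrix (Fin n) (Fin n) (ZMod p)) ^ p = 1 := by
    rw [← Matrix.SpecialLinearGroup.coe_pow, hup, Matrix.SpecialLinearGroup.coe_one]
  have hN : N ^ n = 0 := aux_nilp _ hup'
  have hN0 : N ≠ 0 := by
    intro h
    apply hu1
    apply Subtype.ext
    exact sub_eq_zero.1 h
  have h1N : 1 + N = (u : Matrix (Fin n) (Fin n) (ZMod p)) := by rw [hNdef]; abel
  set s := {Y | ∃ g ∈ G, Y = (g : Matrix (Fin n) (Fin n) (ZMod p)) * auxLog N * ((g⁻¹ : Matrix.SpecialLinearGroup (Fin n) (ZMod p)) : Matrix (Fin n) (Fin n) (ZMod p))} with hs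
  have hrank : d ≤ Module.finrank (ZMod p) (Submodule.span (ZMod p) s) := by
    apply aux_finrank (by omega)
    refine hG _ (aux_conj_span G (auxLog N)) (auxLog N) ?_ (auxLog_spec hnp hn N hN hN0)
    exact Submodule.subset_span ⟨1, G.one_mem, by simp⟩
  obtain ⟨L', hL's, -, hL'ind⟩ := Submodule.exists_fun_fin_finrank_span_eq (ZMod p) s
  let L : Fin d → Matrix (Fin n) (Fin n) (ZMod p) := fun i => L' (Fin.castLE hrank i)
  have hLind : LinearIndependent (ZMod p) L := hL'ind.comp _ (Fin.castLE_injective hrank)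
  choose g hgG hgL using fun i => hL's (Fin.castLE hrank i)
  obtain ⟨ℓ, hℓ⟩ := LinearMap.exists_leftInverse_of_injective (Fintype.linearCombination (ZMod p) L)
    (LinearMap.ker_eq_bot.2 (linearIndependent_iff_injective_fintypeLinearCombination.1 hLind))
  have hℓL : ∀ i, ℓ (L i) = Pi.single i 1 := by
    intro i
    have := LinearMap.congr_fun hℓ (Pi.single i 1)
    simpa [Fintype.linearCombination_apply_single] using this
  have hℓsum : ∀ (M : Matrix (Fin n) (Fin n) (ZMod p)) j, ℓ M j = ∑ a, ∑ b, ℓ (Matrix.single a b 1) j * M a b := by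
    intro M j
    conv_lhs => rw [Matrix.matrix_eq_sum_single M]
    simp only [map_sum, Finset.sum_apply]
    refine Finset.sum_congr rfl fun a _ => Finset.sum_congr rfl fun b _ => ?_
    have e : Matrix.single a b (M a b) = M a b • Matrix.single a b (1 : ZMod p) := by
      rw [Matrix.smul_single, smul_eq_mul, mul_one]
    rw [e, map_smul, Pi.smul_apply, smul_eq_mul, mul_comm]
  choose B hBdeg hBev hBmod using fun i : Fin d => aux_onepar hnp N hN (by omega) i
  let Cm : Matrix (Fin n) (Fin n) (ZMod p) →+* Matrix (Fin n) (Fin n) (MvPolynomial (Fin d) (ZMod p)) :=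
    (MvPolynomial.C : ZMod p →+* MvPolynomial (Fin d) (ZMod p)).mapMatrix
  have hCm : ∀ M a b, Cm M a b = MvPolynomial.C (M a b) := fun _ _ _ => rfl
  let A : Fin d → Matrix (Fin n) (Fin n) (MvPolynomial (Fin d) (ZMod p)) := fun i =>
    Cm (g i) * B i * Cm ((g i)⁻¹ : Matrix.SpecialLinearGroup (Fin n) (ZMod p))
  have hAdeg : ∀ i a b, (A i a b).totalDegree ≤ n := by
    intro i a b
    simp only [A, Matrix.mul_apply]
    refine MvPolynomial.totalDegree_finsetSum_le fun k hk => ?_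
    refine (MvPolynomial.totalDegree_mul _ _).trans ?_
    rw [hCm, MvPolynomial.totalDegree_C, add_zero]
    refine MvPolynomial.totalDegree_finsetSum_le fun k' hk' => ?_
    refine (MvPolynomial.totalDegree_mul _ _).trans ?_
    rw [hCm, MvPolynomial.totalDegree_C, zero_add]
    exact hBdeg _ _ _
  have hAmod : ∀ i, (Ideal.Quotient.mk (MvPolynomial.idealOfVars (Fin d) (ZMod p) ^ 2)).mapMatrix (A i) =
        1 + (Ideal.Quotient.mk (MvPolynomial.idealOfVars (Fin d) (ZMod p) ^ 2) (MvPolynomial.X i)) •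
          ((Ideal.Quotient.mk (MvPolynomial.idealOfVars (Fin d) (ZMod p) ^ 2)).comp MvPolynomial.C).mapMatrix (L i) := by
    intro i
    have hQ : ∀ M, (Ideal.Quotient.mk (MvPolynomial.idealOfVars (Fin d) (ZMod p) ^ 2)).mapMatrix (Cm M) =
      ((Ideal.Quotient.mk (MvPolynomial.idealOfVars (Fin d) (ZMod p) ^ 2)).comp MvPolynomial.C).mapMatrix M := fun _ => rfl
    simp only [A]
    rw [map_mul, map_mul, hBmod, hQ, hQ]
    have : L i = _ := hgL i
    rw [this, map_mul, map_mul, mul_add, mul_one, add_mul, ← map_mul, ← Matrix.SpecialLinearGroup.coe_mul, mul_inv_cancel,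
      Matrix.SpecialLinearGroup.coe_one, map_one, mul_smul_comm, smul_mul_assoc]
  obtain ⟨hPdeg, hPmod⟩ := aux_prodlist A L hAdeg hAmod (List.finRange d)
  set P := ((List.finRange d).map A).prod with hP
  rw [← Fin.sum_univ_def] at hPmod
  rw [List.length_finRange] at hPdeg
  -- evaluation
  have hPev : ∀ x : Fin d → ZMod p, ∃ h ∈ G, (MvPolynomial.eval x).mapMatrix P = (h : Matrix (Fin n) (Fin n) (ZMod p)) := by
    intro x
    have hev : ∀ i, (MvPolynomial.eval x).mapMatrix (A i) = ((g i * u ^ (x i).val * (g i)⁻¹ : Matrix.SpecialLinearGroup (Fin n) (ZMod p)) : Matrix (Fin n) (Fin n) (ZMod p)) := by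
      intro i
      have hQ : ∀ M, (MvPolynomial.eval x).mapMatrix (Cm M) = M := by
        intro M; ext a b; simp [Cm]
      simp only [A]
      rw [map_mul, map_mul, hQ, hQ, hBev, h1N, Matrix.SpecialLinearGroup.coe_mul, Matrix.SpecialLinearGroup.coe_mul, Matrix.SpecialLinearGroup.coe_pow]
    rw [hP]
    generalize List.finRange d = l
    induction l with
    | nil => exact ⟨1, G.one_mem, by simp⟩
    | cons i l ih =>
      obtain ⟨h, hh, e⟩ := ih
      refine ⟨g i * u ^ (x i).val * (g i)⁻¹ * h, G.mul_mem (G.mul_mem (G.mul_mem (hgG i) (G.pow_mem hu _)) (G.inv_mem (hgG i))) hh, ?_⟩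
      rw [List.map_cons, List.prod_cons, map_mul, e, hev, ← Matrix.SpecialLinearGroup.coe_mul]
  let f : Fin d → MvPolynomial (Fin d) (ZMod p) := fun j => ∑ a, ∑ b, MvPolynomial.C (ℓ (Matrix.single a b 1) j) * P a b
  have hfdeg : ∀ j, (f j).totalDegree ≤ d * n := by
    intro j
    refine MvPolynomial.totalDegree_finsetSum_le fun a _ => MvPolynomial.totalDegree_finsetSum_le fun b _ => ?_
    refine (MvPolynomial.totalDegree_mul _ _).trans ?_
    rw [MvPolynomial.totalDegree_C, zero_add]
    exact hPdeg a b
  have hfmod : ∀ j, f j - MvPolynomial.C (ℓ 1 j) - MvPolynomial.X j ∈ MvPolynomial.idealOfVars (Fin d) (ZMod p) ^ 2 := by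
    intro j
    rw [← Ideal.Quotient.eq_zero_iff_mem, map_sub, map_sub, sub_sub, sub_eq_zero]
    have hPab : ∀ a b, (Ideal.Quotient.mk (MvPolynomial.idealOfVars (Fin d) (ZMod p) ^ 2)) (P a b) =
        Ideal.Quotient.mk _ (MvPolynomial.C ((1 : Matrix (Fin n) (Fin n) (ZMod p)) a b)) + ∑ i, Ideal.Quotient.mk _ (MvPolynomial.X i) * 
          Ideal.Quotient.mk _ (MvPolynomial.C (L i a b)) := by
      intro a b
      have := congrFun (congrFun hPmod a) b
      rw [RingHom.mapMatrix_apply, Matrix.map_apply] at this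
      rw [this, Matrix.add_apply, Matrix.sum_apply]
      congr 1
      by_cases hab : a = b <;> simp [hab, Matrix.one_apply]
    simp only [f, map_sum, map_mul, hPab, mul_add, Finset.sum_add_distrib]
    congr 1
    · rw [hℓsum 1 j]
      simp only [map_sum, map_mul]
    · simp only [Finset.mul_sum]
      rw [Finset.sum_congr rfl fun a _ => Finset.sum_comm, Finset.sum_comm]
      have : ∀ i, ∑ a, ∑ b, Ideal.Quotient.mk (MvPolynomial.idealOfVars (Fin d) (ZMod p) ^ 2) (MvPolynomial.C (ℓ (Matrix.single a b 1) j)) *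
          (Ideal.Quotient.mk _ (MvPolynomial.X i) * Ideal.Quotient.mk _ (MvPolynomial.C (L i a b))) =
          Ideal.Quotient.mk _ (MvPolynomial.X i) * Ideal.Quotient.mk _ (MvPolynomial.C (ℓ (L i) j)) := by
        intro i
        rw [hℓsum (L i) j]
        simp only [map_sum, map_mul, Finset.mul_sum]
        exact Finset.sum_congr rfl fun a _ => Finset.sum_congr rfl fun b _ => by ring
      rw [Finset.sum_congr rfl fun i _ => this i, Finset.sum_eq_single j]
      · rw [hℓL]; simp
      · intro i _ hij
        rw [hℓL, Pi.single_eq_of_ne hij.symm]; simp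
      · simp
  refine (aux_count f (ℓ 1) hfmod hfdeg hm).trans ?_
  have hfin : Finite G := inferInstance
  have hsub : Set.range (fun (x : Fin d → ZMod p) (j : Fin d) => MvPolynomial.eval x (f j)) ⊆
      Set.range (fun h : G => ℓ (h : Matrix.SpecialLinearGroup (Fin n) (ZMod p))) := by
    rintro _ ⟨x, rfl⟩
    obtain ⟨h, hh, e⟩ := hPev x
    refine ⟨⟨h, hh⟩, ?_⟩
    funext j
    simp only
    rw [hℓsum, ← e]
    simp [f]
  refine (Nat.card_mono (Set.toFinite _) hsub).trans ?_
  exact Finite.card_range_le _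


theorem aux_near {A G : Type*} [NormedRing A] [StarRing A] [CStarRing A] [NormedAlgebra ℂ A] [Nontrivial A]
    [Group G] [Finite G] (n : ℕ) (hn : 0 < n) (ρ : G →* A) (hinj : Function.Injective ρ)
    (hU : ∀ g, ρ g ∈ unitary A)
    (hz : ∀ z ∈ Subgroup.center G, z ^ n = 1)
    (hc : ∀ g, g ∉ Subgroup.center G → ∃ x, ¬ Commute g (x * g * x⁻¹))
    (g : G) (hg : ‖ρ g - 1‖ < 1 / (4 * n)) : g = 1 := by
  have hn' : (0:ℝ) < n := by exact_mod_cast hn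
  have hn1 : (1:ℝ) ≤ n := by exact_mod_cast hn
  have hnorm : ∀ g, ‖ρ g‖ = 1 := fun g => CStarRing.norm_of_mem_unitary (hU g)
  have hcen : ∀ z ∈ Subgroup.center G, ‖ρ z - 1‖ < 1 / (4 * n) → z = 1 := by
    intro z hzc hz1
    have hzn := hz z hzc
    set Z := ρ z with hZ
    have hZn : Z ^ n = 1 := by rw [hZ, ← map_pow, hzn, map_one]
    have hpow : ∀ i : ℕ, ‖Z ^ i - 1‖ ≤ i * ‖Z - 1‖ := by
      intro i
      induction i with
      | zero => simp
      | succ i ih =>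
        have : Z ^ (i+1) - 1 = (Z ^ i - 1) * Z + (Z - 1) := by rw [pow_succ]; noncomm_ring
        rw [this]
        calc _ ≤ ‖(Z ^ i - 1) * Z‖ + ‖Z - 1‖ := norm_add_le _ _
          _ ≤ ‖Z^i - 1‖ * 1 + ‖Z-1‖ := by
            gcongr; rw [← hnorm z]; exact norm_mul_le _ _
          _ ≤ _ := by push_cast; linarith
    have h0 : (∑ i ∈ Finset.range n, Z ^ i) * (Z - 1) = 0 := by
      rw [geom_sum_mul, hZn, sub_self]
    have h1 : (n:ℂ) • (Z - 1) = - ((∑ i ∈ Finset.range n, (Z ^ i - 1)) * (Z - 1)) := by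
      rw [Finset.sum_sub_distrib, sub_mul, h0]
      simp [Algebra.smul_def]
    have h2 : n * ‖Z - 1‖ ≤ (n * (n * ‖Z - 1‖)) * ‖Z - 1‖ := by
      calc n * ‖Z - 1‖ = ‖(n:ℂ) • (Z - 1)‖ := by rw [norm_smul]; simp
        _ ≤ ‖∑ i ∈ Finset.range n, (Z ^ i - 1)‖ * ‖Z - 1‖ := by
          rw [h1, norm_neg]; exact norm_mul_le _ _
        _ ≤ _ := by
          gcongr
          refine (norm_sum_le _ _).trans ?_
          calc _ ≤ ∑ i ∈ Finset.range n, (n * ‖Z - 1‖) := by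
                apply Finset.sum_le_sum
                intro i hi
                refine (hpow i).trans ?_
                gcongr
                exact (Finset.mem_range.mp hi).le
            _ = _ := by simp
    have h3 : ‖Z - 1‖ = 0 := by
      by_contra hne
      have hpos : 0 < ‖Z - 1‖ := lt_of_le_of_ne (norm_nonneg _) (Ne.symm hne)
      have h4 : n * ‖Z - 1‖ < 1 / 4 := by
        calc n * ‖Z-1‖ < n * (1 / (4 * n)) := by gcongr
          _ = 1/4 := by field_simp
      nlinarith [mul_pos hn' hpos]
    apply hinj
    rw [map_one]
    exact sub_eq_zero.mp (norm_eq_zero.mp h3)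
  have hcomm : ∀ g h : G, ‖ρ (g * h * g⁻¹ * h⁻¹) - 1‖ ≤ 2 * ‖ρ g - 1‖ * ‖ρ h - 1‖ := by
    intro g h
    have : ρ (g * h * g⁻¹ * h⁻¹) - 1 = ((ρ g - 1) * (ρ h - 1) - (ρ h - 1) * (ρ g - 1)) * ρ (g⁻¹ * h⁻¹) := by
      have e : (1:A) = ρ (h * g) * ρ (g⁻¹ * h⁻¹) := by rw [← map_mul]; simp [mul_assoc]
      have e2 : ρ (g * h * g⁻¹ * h⁻¹) = ρ (g * h) * ρ (g⁻¹ * h⁻¹) := by rw [← map_mul]; simp [mul_assoc]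
      rw [e2]
      nth_rewrite 1 [e]
      rw [← sub_mul, map_mul, map_mul ρ h g]
      congr 1
      noncomm_ring
    rw [this]
    refine (norm_mul_le _ _).trans ?_
    rw [hnorm, mul_one]
    refine (norm_sub_le _ _).trans ?_
    have := norm_mul_le (ρ g - 1) (ρ h - 1)
    have := norm_mul_le (ρ h - 1) (ρ g - 1)
    nlinarith
  by_cases hall : ∀ g : G, ‖ρ g - 1‖ < 1 / (4 * n) → g ∈ Subgroup.center G
  · exact hcen g (hall g hg) hg
  exfalso
  push Not at hall
  let S : Set G := {g | ‖ρ g - 1‖ < 1 / (4 * n) ∧ g ∉ Subgroup.center G}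
  obtain ⟨g, ⟨hg1, hg2⟩, hmin⟩ := Set.exists_min_image S (fun g => ‖ρ g - 1‖) (Set.toFinite S) hall
  obtain ⟨x, hx⟩ := hc g hg2
  set h := x * g * x⁻¹ with hh
  have hhn : ‖ρ h - 1‖ ≤ ‖ρ g - 1‖ := by
    have : ρ h - 1 = ρ x * (ρ g - 1) * ρ x⁻¹ := by
      rw [mul_sub, sub_mul, ← map_mul, ← map_mul, mul_one, ← map_mul]; simp [hh]
    rw [this]
    refine (norm_mul_le _ _).trans ?_
    rw [hnorm, mul_one]
    refine (norm_mul_le _ _).trans ?_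
    rw [hnorm, one_mul]
  have hgpos : 0 < ‖ρ g - 1‖ := by
    rw [norm_pos_iff, sub_ne_zero]
    intro e
    apply hg2
    have : g = 1 := hinj (by rw [e, map_one])
    rw [this]; exact one_mem _
  have h14 : 1 / (4 * (n:ℝ)) ≤ 1/4 := by
    rw [div_le_div_iff₀ (by positivity) (by norm_num)]; linarith
  have hlt : ‖ρ (g * h * g⁻¹ * h⁻¹) - 1‖ < ‖ρ g - 1‖ := by
    refine (hcomm g h).trans_lt ?_
    nlinarith
  have hk : g * h * g⁻¹ * h⁻¹ ∈ Subgroup.center G := by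
    by_contra hk
    have := hmin _ ⟨hlt.trans hg1, hk⟩
    linarith
  have h1 := hcen _ hk (hlt.trans hg1)
  apply hx
  show g * h = h * g
  have := mul_inv_eq_one.mp h1
  have := mul_inv_eq_iff_eq_mul.mp this
  exact this

section
open scoped Matrix.Norms.L2Operator MatrixOrder ComplexOrder

theorem aux_unitarize {n : ℕ} {G : Type*} [Group G] [Finite G] (ρ : G →* Matrix (Fin n) (Fin n) ℂ) :
    ∃ ρ' : G →* Matrix (Fin n) (Fin n) ℂ, (∀ g, ρ' g ∈ unitary (Matrix (Fin n) (Fin n) ℂ)) ∧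
      (Function.Injective ρ → Function.Injective ρ') := by
  classical
  haveI := Fintype.ofFinite G
  set P : Matrix (Fin n) (Fin n) ℂ := ∑ g, (ρ g)ᴴ * ρ g with hP
  have hunit : ∀ g, ρ g * ρ g⁻¹ = 1 := fun g => by rw [← map_mul]; simp
  have hunit' : ∀ g, ρ g⁻¹ * ρ g = 1 := fun g => by rw [← map_mul]; simp
  have hPD : P.PosDef := by
    have h1 : (((ρ 1)ᴴ * ρ 1 : Matrix (Fin n) (Fin n) ℂ)).PosDef := by
      simp; exact Matrix.PosDef.one
    rw [hP, ← Finset.add_sum_erase _ _ (Finset.mem_univ (1:G))]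
    exact h1.add_posSemidef (Matrix.posSemidef_sum _ fun g _ => Matrix.posSemidef_conjTranspose_mul_self _)
  have hinv : ∀ g, (ρ g)ᴴ * P * ρ g = P := by
    intro g
    rw [hP, Finset.mul_sum, Finset.sum_mul]
    refine Fintype.sum_equiv (Equiv.mulRight g) _ _ ?_
    intro x
    simp [mul_assoc]
  obtain ⟨B, hB⟩ := CStarAlgebra.nonneg_iff_eq_star_mul_self.mp hPD.posSemidef.nonneg
  have hPu := hPD.isUnit
  have hBu : IsUnit B := by
    rw [Matrix.isUnit_iff_isUnit_det] at hPu ⊢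
    rw [hB, Matrix.det_mul] at hPu
    exact isUnit_of_mul_isUnit_right hPu
  obtain ⟨b, rfl⟩ := hBu
  let ρ' : G →* Matrix (Fin n) (Fin n) ℂ :=
    { toFun := fun g => b * ρ g * (↑b⁻¹ : Matrix (Fin n) (Fin n) ℂ)
      map_one' := by simp
      map_mul' := fun x y => by simp [mul_assoc] }
  have hρ' : ∀ g, ρ' g = b * ρ g * (↑b⁻¹ : Matrix (Fin n) (Fin n) ℂ) := fun g => rfl
  refine ⟨ρ', ?_, ?_⟩
  · intro g
    have key : star (ρ' g) * ρ' g = 1 := by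
      have h1 : star (ρ' g) * ρ' g = star (↑b⁻¹ : Matrix (Fin n) (Fin n) ℂ) * ((ρ g)ᴴ * (star (b : Matrix (Fin n) (Fin n) ℂ) * b) * ρ g) * (↑b⁻¹ : Matrix (Fin n) (Fin n) ℂ) := by
        rw [hρ']
        simp only [star_mul, mul_assoc, Matrix.star_eq_conjTranspose]
      rw [h1, ← hB, hinv, hB]
      have h2 : (b : Matrix (Fin n) (Fin n) ℂ) * (↑b⁻¹ : Matrix (Fin n) (Fin n) ℂ) = 1 := by simp
      rw [mul_assoc, mul_assoc, h2, mul_one, ← star_mul, h2, star_one]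
    exact ⟨key, _root_.mul_eq_one_comm.mp key⟩
  · intro hi x y hxy
    apply hi
    rw [hρ', hρ'] at hxy
    exact b.isUnit.mul_left_cancel (b⁻¹.isUnit.mul_right_cancel hxy)

theorem aux_jordan (n : ℕ) (hn : 0 < n) : ∃ M : ℕ, ∀ (G : Type) [Group G] [Finite G]
    (ρ : G →* Matrix (Fin n) (Fin n) ℂ), Function.Injective ρ →
    (∀ z ∈ Subgroup.center G, z ^ n = 1) →
    (∀ g, g ∉ Subgroup.center G → ∃ x, ¬ Commute g (x * g * x⁻¹)) → Nat.card G ≤ M := by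
  classical
  haveI : Nonempty (Fin n) := ⟨⟨0, hn⟩⟩
  have hn' : (0:ℝ) < n := by exact_mod_cast hn
  haveI : ProperSpace (Matrix (Fin n) (Fin n) ℂ) := FiniteDimensional.proper ℂ _
  have hK := (isCompact_closedBall (0 : Matrix (Fin n) (Fin n) ℂ) 1).totallyBounded
  obtain ⟨t, htf, ht⟩ := Metric.totallyBounded_iff.mp hK (1 / (8 * n)) (by positivity)
  refine ⟨t.ncard, ?_⟩
  intro G _ _ ρ hρ hz hc
  obtain ⟨σ, hU, hi⟩ := aux_unitarize ρ
  have hmem : ∀ g, ∃ y ∈ t, dist (σ g) y < 1 / (8 * n) := by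
    intro g
    have : σ g ∈ Metric.closedBall (0 : Matrix (Fin n) (Fin n) ℂ) 1 := by
      rw [mem_closedBall_zero_iff]; exact (CStarRing.norm_of_mem_unitary (hU g)).le
    simpa using ht this
  choose f hft hfd using hmem
  have hfi : Function.Injective f := by
    intro x y hxy
    have hd : dist (σ x) (σ y) < 1 / (4 * n) := by
      have h1 := hfd x
      have h2 := hfd y
      rw [← hxy, dist_comm] at h2
      have h3 := dist_triangle (σ x) (f x) (σ y)
      have : (1:ℝ) / (4 * n) = 1 / (8 * n) + 1 / (8 * n) := by field_simp; norm_num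
      linarith
    have := aux_near n hn σ (hi hρ) hU hz hc (x * y⁻¹) (by
      have : σ (x * y⁻¹) - 1 = (σ x - σ y) * σ y⁻¹ := by
        rw [sub_mul, ← map_mul, ← map_mul]; simp
      rw [this]
      refine (norm_mul_le _ _).trans_lt ?_
      rw [CStarRing.norm_of_mem_unitary (hU _), mul_one, ← dist_eq_norm]
      exact hd)
    exact mul_inv_eq_one.mp this
  haveI := htf.to_subtype
  calc Nat.card G ≤ Nat.card t := Nat.card_le_card_of_injective (fun g => (⟨f g, hft g⟩ : t)) (by
        intro x y hxy; exact hfi (by simpa using hxy))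
    _ = _ := rfl
end


theorem aux_SZ {E Q : Type*} [Group E] [Group Q] [Finite E] (π : E →* Q) (hs : Function.Surjective π)
    (hco : Nat.Coprime (Nat.card π.ker) (Nat.card Q)) : ∃ s : Q →* E, ∀ x, π (s x) = x := by
  have hidx : π.ker.index = Nat.card Q := by
    rw [Subgroup.index_ker, MonoidHom.range_eq_top.mpr hs]
    exact Nat.card_congr (Equiv.Set.univ Q)
  obtain ⟨K, hK⟩ := Subgroup.exists_right_complement'_of_coprime (N := π.ker) (by rw [hidx]; exact hco)
  have hbij : Function.Bijective (π.comp K.subtype) := by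
    constructor
    · rw [injective_iff_map_eq_one]
      intro a ha
      have h1 : (a:E) ∈ π.ker := ha
      have := hK.disjoint
      rw [Subgroup.disjoint_def] at this
      exact Subtype.ext (this h1 a.2)
    · intro q
      obtain ⟨e, rfl⟩ := hs q
      obtain ⟨⟨a, b⟩, hab⟩ := hK.surjective e
      refine ⟨b, ?_⟩
      have ha : π (a:E) = 1 := a.2
      simp only [← hab, map_mul, ha, one_mul]
      rfl
  let e := MulEquiv.ofBijective _ hbij
  refine ⟨K.subtype.comp e.symm.toMonoidHom, fun x => ?_⟩
  exact e.apply_symm_apply x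

theorem aux_zmod_unit {p k : ℕ} [Fact p.Prime] (x : ZMod (p ^ (k+1)))
    (hx : ZMod.castHom (dvd_pow_self p (Nat.succ_ne_zero k)) (ZMod p) x ≠ 0) : IsUnit x := by
  haveI : NeZero (p ^ (k+1)) := ⟨pow_ne_zero _ (Fact.out : p.Prime).ne_zero⟩
  have e := ZMod.natCast_zmod_val x
  rw [← e] at hx ⊢
  rw [ZMod.isUnit_iff_coprime]
  rw [map_natCast] at hx
  apply Nat.Coprime.pow_right
  rw [Nat.coprime_comm, Nat.Prime.coprime_iff_not_dvd Fact.out]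
  intro h
  exact hx ((ZMod.natCast_eq_zero_iff _ _).mpr h)

theorem aux_lift_k {n p : ℕ} (k : ℕ) [Fact p.Prime] (G : Subgroup (Matrix.SpecialLinearGroup (Fin n) (ZMod p)))
    (hG : ¬ p ∣ Nat.card G) :
    ∃ σ : G →* Matrix (Fin n) (Fin n) (ZMod (p ^ (k+1))), ∀ g : G,
      (σ g).map (ZMod.castHom (dvd_pow_self p (Nat.succ_ne_zero k)) (ZMod p))
        = ((g : Matrix.SpecialLinearGroup (Fin n) (ZMod p)) : Matrix (Fin n) (Fin n) (ZMod p)) := by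
  classical
  haveI : NeZero (p ^ (k+1)) := ⟨pow_ne_zero _ (Fact.out : p.Prime).ne_zero⟩
  set c := ZMod.castHom (dvd_pow_self p (Nat.succ_ne_zero k)) (ZMod p) with hc
  have hcs : Function.Surjective c := ZMod.castHom_surjective _
  let f : Matrix (Fin n) (Fin n) (ZMod (p ^ (k+1))) →+* Matrix (Fin n) (Fin n) (ZMod p) := c.mapMatrix
  have hfu : ∀ X, IsUnit (f X) → IsUnit X := by
    intro X hX
    rw [Matrix.isUnit_iff_isUnit_det] at hX ⊢
    apply aux_zmod_unit
    have : c X.det = (f X).det := by rw [RingHom.map_det]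
    rw [← hc, this]
    exact hX.ne_zero
  have hfs : Function.Surjective f := by
    intro Y
    choose r hr using hcs
    refine ⟨Y.map r, ?_⟩
    ext i j
    simp [f, hr]
  let F := Units.map (f : Matrix (Fin n) (Fin n) (ZMod (p ^ (k+1))) →* Matrix (Fin n) (Fin n) (ZMod p))
  let E := MonoidHom.eqLocus (F.comp (MonoidHom.fst (Matrix (Fin n) (Fin n) (ZMod (p ^ (k+1))))ˣ G))
    ((Matrix.SpecialLinearGroup.toGL.comp G.subtype).comp (MonoidHom.snd _ G))
  let π : E →* G := (MonoidHom.snd _ G).comp E.subtype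
  have hπs : Function.Surjective π := by
    intro g
    obtain ⟨X, hX⟩ := hfs ((g : Matrix.SpecialLinearGroup (Fin n) (ZMod p)) : Matrix (Fin n) (Fin n) (ZMod p))
    have hu : IsUnit X := hfu X (by
      rw [hX]; exact (Matrix.SpecialLinearGroup.toGL (g : Matrix.SpecialLinearGroup (Fin n) (ZMod p))).isUnit)
    refine ⟨⟨(hu.unit, g), ?_⟩, rfl⟩
    apply Units.ext
    exact hX
  have hcard : Nat.card π.ker = Nat.card f.toAddMonoidHom.ker := by
    refine Nat.card_congr ⟨fun x => ⟨((x.1.1.1 : (Matrix (Fin n) (Fin n) (ZMod (p ^ (k+1))))ˣ) : Matrix _ _ _) - 1, ?_⟩,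
      fun y => ⟨⟨((hfu (y.1 + 1) ?_).unit, 1), ?_⟩, ?_⟩, ?_, ?_⟩
    · obtain ⟨⟨⟨u, g⟩, hu⟩, hx⟩ := x
      have hg : g = 1 := hx
      have h1 : F u = Matrix.SpecialLinearGroup.toGL (g : Matrix.SpecialLinearGroup (Fin n) (ZMod p)) := hu
      have h2 := congrArg Units.val h1
      show f (_ - 1) = 0
      rw [map_sub, map_one, sub_eq_zero]
      rw [hg] at h2
      exact h2
    · have : f y.1 = 0 := y.2
      rw [map_add, this, map_one, zero_add]; exact isUnit_one
    · apply Units.ext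
      have : f y.1 = 0 := y.2
      have h : f (y.1 + 1) = 1 := by rw [map_add, this, map_one, zero_add]
      exact h
    · rfl
    · rintro ⟨⟨⟨u, g⟩, hu⟩, hx⟩
      have hg : g = 1 := hx
      subst hg
      apply Subtype.ext; apply Subtype.ext
      apply Prod.ext
      · apply Units.ext
        simp
      · rfl
    · intro y
      apply Subtype.ext
      simp
  have hco : Nat.Coprime (Nat.card π.ker) (Nat.card G) := by
    rw [hcard]
    have hd := AddSubgroup.card_addSubgroup_dvd_card f.toAddMonoidHom.ker
    apply Nat.Coprime.coprime_dvd_left hd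
    have : Nat.card (Matrix (Fin n) (Fin n) (ZMod (p ^ (k+1)))) = p ^ ((k+1) * n * n) := by
      rw [Matrix, Nat.card_pi, Finset.prod_congr rfl (fun _ _ => Nat.card_pi)]
      simp [pow_mul]
    rw [this]
    exact Nat.Coprime.pow_left _ ((Nat.Prime.coprime_iff_not_dvd Fact.out).mpr hG)
  haveI : Finite E := inferInstance
  obtain ⟨s, hs⟩ := aux_SZ π hπs hco
  refine ⟨(Units.coeHom _).comp ((MonoidHom.fst _ G).comp (E.subtype.comp s)), fun g => ?_⟩
  have h1 : F (s g).1.1 = Matrix.SpecialLinearGroup.toGL ((s g).1.2 : Matrix.SpecialLinearGroup (Fin n) (ZMod p)) := (s g).2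
  have h2 := congrArg Units.val h1
  have h3 : (s g).1.2 = g := hs g
  rw [h3] at h2
  exact h2

theorem aux_embed (A : Type) [CommRing A] [IsDomain A] [CharZero A] (hA : Cardinal.mk A ≤ Cardinal.continuum) :
    Nonempty (A →+* ℂ) := by
  let B := MvPolynomial ℝ A
  let K := AlgebraicClosure (FractionRing B)
  have hB : Cardinal.mk B = Cardinal.continuum := by
    rw [MvPolynomial.cardinalMk_eq_max, Cardinal.mk_real, sup_eq_right.mpr hA, sup_eq_left.mpr Cardinal.aleph0_le_continuum]
  haveI : CharZero B := inferInstance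
  haveI : CharZero (FractionRing B) := charZero_of_injective_algebraMap (IsFractionRing.injective B (FractionRing B))
  haveI : CharZero K := charZero_of_injective_algebraMap (algebraMap (FractionRing B) K).injective
  have hF : Cardinal.mk (FractionRing B) = Cardinal.continuum := by rw [Cardinal.mk_fractionRing, hB]
  have hK : Cardinal.mk K = Cardinal.continuum := by
    apply le_antisymm
    · have := Algebra.IsAlgebraic.cardinalMk_le_max (FractionRing B) K
      rwa [hF, sup_eq_left.mpr Cardinal.aleph0_le_continuum] at this
    · rw [← hF]
      exact Cardinal.mk_le_of_injective (algebraMap (FractionRing B) K).injective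
  obtain ⟨e⟩ := IsAlgClosed.ringEquiv_of_equiv_of_charZero (K := K) (L := ℂ)
    (by rw [hK]; exact Cardinal.aleph0_lt_continuum) (Cardinal.eq.mp (by rw [hK, Cardinal.mk_complex]))
  exact ⟨(e : K →+* ℂ).comp ((algebraMap (FractionRing B) K).comp ((algebraMap B (FractionRing B)).comp MvPolynomial.C))⟩

theorem aux_lift {n p : ℕ} [Fact p.Prime] (G : Subgroup (Matrix.SpecialLinearGroup (Fin n) (ZMod p)))
    (hG : ¬ p ∣ Nat.card G) :
    ∃ σ : G →* Matrix (Fin n) (Fin n) ℂ, Function.Injective σ := by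
  classical
  choose σ hσ using fun k => aux_lift_k k G hG
  let R := ∀ k : ℕ, ZMod (p ^ (k+1))
  have hp : p.Prime := Fact.out
  have hpn : Disjoint ((⊥ : Ideal R) : Set R) (Submonoid.powers (p : R) : Set R) := by
    rw [Set.disjoint_left]
    rintro x hx ⟨m, rfl⟩
    have h0 : ((p : R) ^ m) = 0 := hx
    have h1 := congrFun h0 m
    have h2 : ((p ^ m : ℕ) : ZMod (p ^ (m+1))) = 0 := by
      push_cast; exact h1
    rw [ZMod.natCast_eq_zero_iff] at h2
    have := (Nat.pow_dvd_pow_iff_le_right hp.one_lt).mp h2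
    omega
  obtain ⟨P, hP, -, hdis⟩ := Ideal.exists_le_prime_disjoint _ _ hpn
  let A := R ⧸ P
  have hpA : (p : A) ≠ 0 := by
    intro h
    have : (p : R) ∈ P := by
      rw [← Ideal.Quotient.eq_zero_iff_mem, map_natCast]; exact h
    exact Set.disjoint_left.mp hdis this (Submonoid.mem_powers _)
  have hunit : ∀ x : R, (∀ k, IsUnit (x k)) → IsUnit x := fun x hx => Pi.isUnit_iff.mpr hx
  haveI : CharZero A := by
    apply charZero_of_inj_zero
    intro m hm
    by_contra hm0
    obtain ⟨a, b, hb, rfl⟩ := Nat.exists_eq_pow_mul_and_not_dvd hm0 p hp.ne_one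
    have hm : ((p:A) ^ a) * (b : A) = 0 := by rw [← hm, Nat.cast_mul, Nat.cast_pow]
    rcases mul_eq_zero.mp hm with h | h
    · exact hpA (IsReduced.pow_eq_zero h)
    · have hu : IsUnit (b : R) := hunit _ fun k => by
        have : ((b : R) k) = ((b : ℕ) : ZMod (p ^ (k+1))) := rfl
        rw [this, ZMod.isUnit_iff_coprime]
        exact Nat.Coprime.pow_right _ (Nat.coprime_comm.mp ((Nat.Prime.coprime_iff_not_dvd hp).mpr hb))
      have := hu.map (Ideal.Quotient.mk P)
      rw [map_natCast] at this
      exact this.ne_zero h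
  have hcard : Cardinal.mk A ≤ Cardinal.continuum := by
    refine (Cardinal.mk_le_of_surjective (Ideal.Quotient.mk_surjective (I := P))).trans ?_
    rw [Cardinal.mk_pi]
    calc _ ≤ Cardinal.prod (fun _ : ℕ => Cardinal.aleph0) := Cardinal.prod_le_prod _ _ (fun k => by
            haveI : NeZero (p ^ (k+1)) := ⟨pow_ne_zero _ hp.ne_zero⟩
            exact Cardinal.mk_le_aleph0)
      _ = _ := by simp
  obtain ⟨θ⟩ := aux_embed A hcard
  let ψ : R →+* ℂ := θ.comp (Ideal.Quotient.mk P)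
  let τ : G →* Matrix (Fin n) (Fin n) R :=
    { toFun := fun g => Matrix.of fun i j k => σ k g i j
      map_one' := by
        ext i j k
        simp [Matrix.one_apply]
        split_ifs <;> rfl
      map_mul' := fun x y => by
        ext i j k
        simp [Matrix.mul_apply]
        rw [Finset.sum_apply]; rfl }
  refine ⟨(RingHom.mapMatrix (m := Fin n) ψ).toMonoidHom.comp τ, ?_⟩
  rw [injective_iff_map_eq_one]
  intro g hg
  by_contra hg1
  have : ∃ i j, ((g : Matrix.SpecialLinearGroup (Fin n) (ZMod p)) : Matrix (Fin n) (Fin n) (ZMod p)) i j ≠ (1 : Matrix (Fin n) (Fin n) (ZMod p)) i j := by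
    by_contra hh
    push Not at hh
    apply hg1
    apply Subtype.ext; apply Subtype.ext
    ext i j
    exact hh i j
  obtain ⟨i, j, hij⟩ := this
  have hu : IsUnit (τ g i j - (1 : Matrix (Fin n) (Fin n) R) i j) := hunit _ fun k => by
    apply aux_zmod_unit
    have e1 : ((1 : Matrix (Fin n) (Fin n) R) i j) k = (1 : Matrix (Fin n) (Fin n) (ZMod (p ^ (k+1)))) i j := by
      simp only [Matrix.one_apply]; split_ifs <;> rfl
    have e2 : τ g i j k = σ k g i j := rfl
    have e3 := congrFun (congrFun (hσ k g) i) j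
    rw [Matrix.map_apply] at e3
    rw [Pi.sub_apply, map_sub, e1, e2, e3, sub_ne_zero]
    convert hij using 1
    simp only [Matrix.one_apply]; split_ifs <;> simp
  have hu2 := (hu.map ψ).ne_zero
  apply hu2
  rw [map_sub, sub_eq_zero]
  have := congrFun (congrFun hg i) j
  have h3 : ψ (τ g i j) = (1 : Matrix (Fin n) (Fin n) ℂ) i j := this
  rw [h3]
  simp only [Matrix.one_apply]; split_ifs <;> simp


theorem aux_qpow {R : Type*} [Ring R] {q : ℕ} (hq : q.Prime) (T : R) :
    ∃ A : R, (1 + T) ^ q = 1 + (q:ℤ) • T + (q:ℤ) • (T ^ 2 * A) + T ^ q := by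
  obtain ⟨r, hr⟩ := exists_add_pow_prime_eq hq (1 : Polynomial ℤ) Polynomial.X
  have hr0 : r.coeff 0 = 1 := by
    have h1 := congrArg (fun f => Polynomial.coeff f 1) hr
    have h2 : (1 : Polynomial ℤ) ^ q = 1 := one_pow _
    simp only [Polynomial.coeff_one_add_X_pow, h2, Polynomial.coeff_add, mul_one, mul_assoc] at h1
    rw [← map_natCast (Polynomial.C : ℤ →+* Polynomial ℤ) q, Polynomial.coeff_C_mul, Polynomial.coeff_X_mul, Polynomial.coeff_X_pow,
      if_neg hq.ne_one.symm, Polynomial.coeff_one] at h1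
    simp at h1
    have hq0 : (q:ℤ) ≠ 0 := by exact_mod_cast hq.ne_zero
    have : (q:ℤ) * (r.coeff 0 - 1) = 0 := by linarith
    rcases mul_eq_zero.mp this with h | h
    · exact absurd h hq0
    · linarith
  have hX : Polynomial.X ∣ r - 1 := by
    rw [Polynomial.X_dvd_iff]; simp [hr0]
  obtain ⟨A, hA⟩ := hX
  have hr' : r = 1 + Polynomial.X * A := by rw [← hA]; ring
  refine ⟨Polynomial.aeval T A, ?_⟩
  have := congrArg (Polynomial.aeval T) hr
  rw [hr'] at this
  simp only [map_add, map_mul, map_pow, map_one, Polynomial.aeval_X, map_natCast, one_pow, mul_one] at this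
  rw [this]
  have e : ∀ x : R, (q:ℤ) • x = (q : R) * x := fun x => by simp
  rw [e, e, mul_add, mul_one]
  noncomm_ring

def auxT {n : ℕ} {R : Type*} [CommRing R] (i j : Fin n) (hij : i ≠ j) (c : R) : Matrix.SpecialLinearGroup (Fin n) R :=
  ⟨Matrix.transvection i j c, Matrix.det_transvection_of_ne _ _ hij _⟩

theorem auxT_coe {n : ℕ} {R : Type*} [CommRing R] (i j : Fin n) (hij : i ≠ j) (c : R) :
    ((auxT i j hij c : Matrix.SpecialLinearGroup (Fin n) R) : Matrix (Fin n) (Fin n) R) = 1 + Matrix.single i j c := rfl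

theorem auxT_inv {n : ℕ} {R : Type*} [CommRing R] (i j : Fin n) (hij : i ≠ j) (c : R) :
    (auxT i j hij c)⁻¹ = auxT i j hij (-c) := by
  apply inv_eq_of_mul_eq_one_right
  apply Subtype.ext
  show Matrix.transvection i j c * Matrix.transvection i j (-c) = 1
  rw [Matrix.transvection, Matrix.transvection, ← Matrix.single_neg]
  simp [add_mul, mul_add, hij.symm]

theorem auxT_inv_coe {n : ℕ} {R : Type*} [CommRing R] (i j : Fin n) (hij : i ≠ j) (c : R) :
    (((auxT i j hij c)⁻¹ : Matrix.SpecialLinearGroup (Fin n) R) : Matrix (Fin n) (Fin n) R) = 1 - Matrix.single i j c := by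
  rw [auxT_inv, auxT_coe, sub_eq_add_neg, ← Matrix.single_neg]

theorem aux_trace_mem {n q : ℕ} (L : AddSubgroup (Matrix (Fin n) (Fin n) ℤ))
    (hqL : ∀ W, (q:ℤ) • W ∈ L) (hE : ∀ i j, i ≠ j → Matrix.single i j (1:ℤ) ∈ L)
    (hconj : ∀ (g : Matrix.SpecialLinearGroup (Fin n) ℤ), ∀ Y ∈ L, (g : Matrix (Fin n) (Fin n) ℤ) * Y * ((g⁻¹ : Matrix.SpecialLinearGroup (Fin n) ℤ) : Matrix (Fin n) (Fin n) ℤ) ∈ L)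
    (Y : Matrix (Fin n) (Fin n) ℤ) (hY : (q:ℤ) ∣ Y.trace) : Y ∈ L := by
  have hD : ∀ i j : Fin n, i ≠ j → Matrix.single i i (1:ℤ) - Matrix.single j j 1 ∈ L := by
    intro i j hij
    have h1 := hconj (auxT j i hij.symm 1) _ (hE i j hij)
    rw [auxT_inv_coe, auxT_coe] at h1
    have h2 : (1 + Matrix.single j i (1:ℤ)) * Matrix.single i j 1 * (1 - Matrix.single j i 1)
       = Matrix.single i j 1 + Matrix.single j j 1 - Matrix.single i i 1 - Matrix.single j i 1 := by
      simp [add_mul, mul_sub, mul_add, hij, hij.symm]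
      abel
    rw [h2] at h1
    have h3 := L.sub_mem (L.sub_mem (hE i j hij) (hE j i hij.symm)) h1
    convert h3 using 1
    abel
  rcases Nat.eq_zero_or_pos n with rfl | hn
  · have : Y = 0 := by ext i; exact i.elim0
    rw [this]; exact L.zero_mem
  let o : Fin n := ⟨0, hn⟩
  obtain ⟨t, ht⟩ := hY
  have hsum : Y = ∑ i, ∑ j, (Y i j) • (Matrix.single i j (1:ℤ) - if i = j then Matrix.single o o 1 else 0) + (q:ℤ) • (t • Matrix.single o o (1:ℤ)) := by
    have h1 : ∑ i, ∑ j, (Y i j) • (Matrix.single i j (1:ℤ) - if i = j then Matrix.single o o 1 else 0)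
      = Y - Y.trace • Matrix.single o o (1:ℤ) := by
      simp only [smul_sub, Finset.sum_sub_distrib]
      congr 1
      · conv_rhs => rw [Matrix.matrix_eq_sum_single Y]
        simp [Matrix.smul_single]
      · simp [Matrix.trace, Finset.sum_smul]
    rw [h1, ht]
    module
  rw [hsum]
  refine L.add_mem (L.sum_mem fun i _ => L.sum_mem fun j _ => L.zsmul_mem ?_ _) (hqL _)
  by_cases hij : i = j
  · subst hij
    rw [if_pos rfl]
    by_cases hio : i = o
    · rw [hio, sub_self]; exact L.zero_mem
    · exact hD _ _ hio
  · rw [if_neg hij, sub_zero]; exact hE _ _ hij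


theorem aux_SL_mul_inv {n : ℕ} {R : Type*} [CommRing R] (g : Matrix.SpecialLinearGroup (Fin n) R) :
    (g : Matrix (Fin n) (Fin n) R) * ((g⁻¹ : Matrix.SpecialLinearGroup (Fin n) R) : Matrix (Fin n) (Fin n) R) = 1 := by
  rw [← Matrix.SpecialLinearGroup.coe_mul, mul_inv_cancel, Matrix.SpecialLinearGroup.coe_one]

theorem aux_SL_inv_mul {n : ℕ} {R : Type*} [CommRing R] (g : Matrix.SpecialLinearGroup (Fin n) R) :
    ((g⁻¹ : Matrix.SpecialLinearGroup (Fin n) R) : Matrix (Fin n) (Fin n) R) * (g : Matrix (Fin n) (Fin n) R) = 1 := by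
  rw [← Matrix.SpecialLinearGroup.coe_mul, inv_mul_cancel, Matrix.SpecialLinearGroup.coe_one]

/-- leading terms of elements of `H` at level `m+1` -/
def auxLm {n : ℕ} (q : ℕ) (H : Subgroup (Matrix.SpecialLinearGroup (Fin n) ℤ)) (m : ℕ)
    (Y : Matrix (Fin n) (Fin n) ℤ) : Prop :=
  ∃ h ∈ H, ∃ Z : Matrix (Fin n) (Fin n) ℤ, (h : Matrix (Fin n) (Fin n) ℤ) = 1 + ((q:ℤ)^(m+1)) • Y + ((q:ℤ)^(m+2)) • Z

theorem auxLm_zero {n q m : ℕ} (H : Subgroup (Matrix.SpecialLinearGroup (Fin n) ℤ))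
    (W : Matrix (Fin n) (Fin n) ℤ) : auxLm q H m ((q:ℤ) • W) := by
  refine ⟨1, H.one_mem, -W, ?_⟩
  rw [Matrix.SpecialLinearGroup.coe_one]
  module

theorem auxLm_add {n q m : ℕ} (H : Subgroup (Matrix.SpecialLinearGroup (Fin n) ℤ))
    (Y1 Y2 : Matrix (Fin n) (Fin n) ℤ) (h1 : auxLm q H m Y1) (h2 : auxLm q H m Y2) :
    auxLm q H m (Y1 + Y2) := by
  obtain ⟨h1, hh1, Z1, e1⟩ := h1
  obtain ⟨h2, hh2, Z2, e2⟩ := h2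
  refine ⟨h1 * h2, H.mul_mem hh1 hh2, Z1 + Z2 + ((q:ℤ)^m) • (Y1 * Y2) + ((q:ℤ)^(m+1)) • (Y1 * Z2 + Z1 * Y2) + ((q:ℤ)^(m+2)) • (Z1 * Z2), ?_⟩
  rw [Matrix.SpecialLinearGroup.coe_mul, e1, e2]
  simp only [mul_add, add_mul, smul_mul_assoc, mul_smul_comm, one_mul, mul_one]
  module

theorem auxLm_conj {n q m : ℕ} (H : Subgroup (Matrix.SpecialLinearGroup (Fin n) ℤ))
    (hS : ∀ g : Matrix.SpecialLinearGroup (Fin n) ℤ, ∃ h ∈ H, ∃ U : Matrix (Fin n) (Fin n) ℤ,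
      (h : Matrix (Fin n) (Fin n) ℤ) = (g : Matrix (Fin n) (Fin n) ℤ) + (q:ℤ) • U)
    (g : Matrix.SpecialLinearGroup (Fin n) ℤ)
    (Y : Matrix (Fin n) (Fin n) ℤ) (hY : auxLm q H m Y)  :
    auxLm q H m ((g : Matrix (Fin n) (Fin n) ℤ) * Y * ((g⁻¹ : Matrix.SpecialLinearGroup (Fin n) ℤ) : Matrix (Fin n) (Fin n) ℤ)) := by
  obtain ⟨h, hh, Z, e⟩ := hY
  obtain ⟨k, hk, U, eU⟩ := hS g
  set g' := ((g⁻¹ : Matrix.SpecialLinearGroup (Fin n) ℤ) : Matrix (Fin n) (Fin n) ℤ) with hg'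
  set k' := ((k⁻¹ : Matrix.SpecialLinearGroup (Fin n) ℤ) : Matrix (Fin n) (Fin n) ℤ) with hk'
  have hkk : (k : Matrix (Fin n) (Fin n) ℤ) * k' = 1 := aux_SL_mul_inv k
  have hgg : g' * (g : Matrix (Fin n) (Fin n) ℤ) = 1 := aux_SL_inv_mul g
  have ek : k' = g' - (q:ℤ) • (g' * U * k') := by
    calc k' = (g' * (g : Matrix (Fin n) (Fin n) ℤ)) * k' := by rw [hgg, one_mul]
      _ = g' * ((k : Matrix (Fin n) (Fin n) ℤ) - (q:ℤ) • U) * k' := by rw [eU, add_sub_cancel_right]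
      _ = g' * ((k : Matrix (Fin n) (Fin n) ℤ) * k') - (q:ℤ) • (g' * U * k') := by
          simp only [mul_sub, sub_mul, smul_mul_assoc, mul_smul_comm, mul_assoc]
      _ = _ := by rw [hkk, mul_one]
  refine ⟨k * h * k⁻¹, H.mul_mem (H.mul_mem hk hh) (H.inv_mem hk),
    (k : Matrix (Fin n) (Fin n) ℤ) * Z * k' + U * Y * k' - g * Y * (g' * U * k'), ?_⟩
  rw [Matrix.SpecialLinearGroup.coe_mul, Matrix.SpecialLinearGroup.coe_mul, ← hk', e]
  have e1 : (k : Matrix (Fin n) (Fin n) ℤ) * (1 + ((q:ℤ)^(m+1)) • Y + ((q:ℤ)^(m+2)) • Z) * k'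
    = 1 + ((q:ℤ)^(m+1)) • (k * Y * k') + ((q:ℤ)^(m+2)) • (k * Z * k') := by
    simp only [mul_add, add_mul, smul_mul_assoc, mul_smul_comm, mul_one, hkk]
  have e2 : (k : Matrix (Fin n) (Fin n) ℤ) * Y * k' = g * Y * g' + (q:ℤ) • (U * Y * k' - g * Y * (g' * U * k')) := by
    calc (k : Matrix (Fin n) (Fin n) ℤ) * Y * k' = (g : Matrix (Fin n) (Fin n) ℤ) * Y * k' + (q:ℤ) • (U * Y * k') := by
          rw [eU]; simp only [add_mul, smul_mul_assoc]
      _ = g * Y * (g' - (q:ℤ) • (g' * U * k')) + (q:ℤ) • (U * Y * k') := by rw [← ek]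
      _ = _ := by
        rw [mul_sub, mul_smul_comm]; module
  rw [e1, e2]
  module

theorem auxLm_succ {n q m : ℕ} (hq : q.Prime) (hq3 : 3 < q) (H : Subgroup (Matrix.SpecialLinearGroup (Fin n) ℤ))
    (Y : Matrix (Fin n) (Fin n) ℤ) (hY : auxLm q H m Y) : auxLm q H (m+1) Y := by
  obtain ⟨h, hh, Z, e⟩ := hY
  set X := Y + (q:ℤ) • Z with hX
  have e' : (h : Matrix (Fin n) (Fin n) ℤ) = 1 + ((q:ℤ)^(m+1)) • X := by rw [e, hX]; module
  obtain ⟨A, hA⟩ := aux_qpow hq (((q:ℤ)^(m+1)) • X)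
  obtain ⟨r, rfl⟩ : ∃ r, q = r + 3 := ⟨q - 3, by omega⟩
  set Q : ℤ := ((r + 3 : ℕ) : ℤ) with hQ
  refine ⟨h ^ (r+3), H.pow_mem hh _, Z + (Q ^ m) • (X ^ 2 * A) + (Q ^ (2*m)) • (X ^ 3 * (Q ^ (m+1) • X) ^ r), ?_⟩
  rw [Matrix.SpecialLinearGroup.coe_pow, e', hA]
  have e3 : (Q ^ (m+1) • X) ^ (r+3) = (Q ^ (3 * (m + 1))) • (X ^ 3 * (Q ^ (m+1) • X) ^ r) := by
    rw [add_comm r 3, pow_add, smul_pow, smul_mul_assoc, ← pow_mul, mul_comm (m+1) 3]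
  have e2 : (Q ^ (m+1) • X) ^ 2 * A = (Q ^ (2 * (m + 1))) • (X ^ 2 * A) := by
    rw [smul_pow, smul_mul_assoc, ← pow_mul, mul_comm (m+1) 2]
  rw [e3, e2, hX, ← hQ]
  module

theorem auxLm_single {n q : ℕ} (hq : q.Prime) (hq3 : 3 < q) (H : Subgroup (Matrix.SpecialLinearGroup (Fin n) ℤ))
    (hS : ∀ g : Matrix.SpecialLinearGroup (Fin n) ℤ, ∃ h ∈ H, ∃ U : Matrix (Fin n) (Fin n) ℤ,
      (h : Matrix (Fin n) (Fin n) ℤ) = (g : Matrix (Fin n) (Fin n) ℤ) + (q:ℤ) • U)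
    (i j : Fin n) (hij : i ≠ j) (m : ℕ) : auxLm q H m (Matrix.single i j 1) := by
  induction m with
  | succ m ih => exact auxLm_succ hq hq3 H _ ih
  | zero =>
    obtain ⟨h, hh, Z, e⟩ := hS (auxT i j hij 1)
    rw [auxT_coe] at e
    set E : Matrix (Fin n) (Fin n) ℤ := Matrix.single i j 1 with hE
    have hEE : E * E = 0 := by simp [hE, hij.symm]
    obtain ⟨r, rfl⟩ : ∃ r, q = r + 4 := ⟨q - 4, by omega⟩
    obtain ⟨A, hA⟩ := aux_qpow hq (E + ((r+4:ℕ):ℤ) • Z)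
    set Q : ℤ := ((r + 4 : ℕ) : ℤ) with hQ
    set T := E + Q • Z with hT
    set W := E * Z + Z * E + Q • (Z * Z) with hW
    have hT2 : T ^ 2 = Q • W := by
      rw [pow_two, hT, hW]
      simp only [mul_add, add_mul, smul_mul_assoc, mul_smul_comm, hEE]
      module
    refine ⟨h ^ (r+4), H.pow_mem hh _, Z + W * A + W ^ 2 * T ^ r, ?_⟩
    have e3 : T ^ (r+4) = (Q ^ 2) • (W ^ 2 * T ^ r) := by
      rw [show r + 4 = 2 * 2 + r by ring, pow_add, pow_mul, hT2, smul_pow, smul_mul_assoc]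
    rw [Matrix.SpecialLinearGroup.coe_pow, e, add_assoc, ← hT, hA, e3, hT2, smul_mul_assoc, hT, ← hQ]
    module

theorem aux_dense {n q : ℕ} (hq : q.Prime) (hq3 : 3 < q) (H : Subgroup (Matrix.SpecialLinearGroup (Fin n) ℤ))
    (hS : ∀ g : Matrix.SpecialLinearGroup (Fin n) ℤ, ∃ h ∈ H, ∃ U : Matrix (Fin n) (Fin n) ℤ,
      (h : Matrix (Fin n) (Fin n) ℤ) = (g : Matrix (Fin n) (Fin n) ℤ) + (q:ℤ) • U) (m : ℕ)
    (g : Matrix.SpecialLinearGroup (Fin n) ℤ) : ∃ h ∈ H, ∃ U : Matrix (Fin n) (Fin n) ℤ,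
      (h : Matrix (Fin n) (Fin n) ℤ) = (g : Matrix (Fin n) (Fin n) ℤ) + ((q:ℤ)^(m+1)) • U := by
  induction m with
  | zero => simpa using hS g
  | succ m ih =>
    obtain ⟨h, hh, U, e⟩ := ih
    have hq0 : (q:ℤ) ≠ 0 := by exact_mod_cast hq.ne_zero
    set Y : Matrix (Fin n) (Fin n) ℤ := - (U * ((h⁻¹ : Matrix.SpecialLinearGroup (Fin n) ℤ) : Matrix (Fin n) (Fin n) ℤ)) with hYdef
    have hgh : ((g * h⁻¹ : Matrix.SpecialLinearGroup (Fin n) ℤ) : Matrix (Fin n) (Fin n) ℤ) = 1 + ((q:ℤ)^(m+1)) • Y := by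
      have : (g : Matrix (Fin n) (Fin n) ℤ) = h - ((q:ℤ)^(m+1)) • U := by rw [e]; abel
      rw [Matrix.SpecialLinearGroup.coe_mul, this, sub_mul, aux_SL_mul_inv, smul_mul_assoc, hYdef]
      module
    have htr : (q:ℤ) ∣ Y.trace := by
      have hdet := (g * h⁻¹).det_coe
      rw [hgh, Matrix.det_one_add_smul] at hdet
      set c := Polynomial.eval ((q:ℤ)^(m+1)) (1 + (Polynomial.X : Polynomial ℤ) • Y.map Polynomial.C).det.divX.divX
      have h2 : (q:ℤ)^(m+1) * (Y.trace + c * (q:ℤ)^(m+1)) = 0 := by linear_combination hdet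
      rcases mul_eq_zero.mp h2 with h3 | h3
      · exact absurd h3 (pow_ne_zero _ hq0)
      · refine ⟨- c * (q:ℤ)^m, ?_⟩
        rw [pow_succ] at h3
        linear_combination h3
    let L : AddSubgroup (Matrix (Fin n) (Fin n) ℤ) :=
      { carrier := {Y | auxLm q H m Y}
        add_mem' := fun h1 h2 => auxLm_add H _ _ h1 h2
        zero_mem' := by
          have := auxLm_zero (q := q) (m := m) H 0
          rwa [smul_zero] at this
        neg_mem' := fun {Y} hY => by
          have hk : ∀ k : ℕ, auxLm q H m (k • Y) := by
            intro k
            induction k with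
            | zero =>
              have := auxLm_zero (q := q) (m := m) H 0
              rwa [smul_zero, ← zero_smul ℕ Y] at this
            | succ k ih => rw [succ_nsmul]; exact auxLm_add H _ _ ih hY
          have h1 := auxLm_add H _ _ (hk (q-1)) (auxLm_zero (q := q) H (-Y))
          have h2 : (q-1) • Y + (q:ℤ) • (-Y) = -Y := by
            obtain ⟨r, rfl⟩ : ∃ r, q = r + 1 := ⟨q - 1, by omega⟩
            rw [Nat.add_sub_cancel, ← natCast_zsmul]
            push_cast
            module
          rw [h2] at h1
          exact h1 }
    have hYL : Y ∈ L := aux_trace_mem (q := q) L (fun W => auxLm_zero H W)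
      (fun i j hij => auxLm_single hq hq3 H hS i j hij m)
      (fun g Y hY => auxLm_conj H hS g Y hY) Y htr
    obtain ⟨k, hk, Z, ek⟩ := hYL
    refine ⟨k * h, H.mul_mem hk hh, Z * h, ?_⟩
    rw [Matrix.SpecialLinearGroup.coe_mul, ek, ← hgh, add_mul, Matrix.SpecialLinearGroup.coe_mul, mul_assoc, aux_SL_inv_mul, mul_one,
      smul_mul_assoc]

def auxV {n : ℕ} (g : Matrix.SpecialLinearGroup (Fin n) ℤ) : Fin n × Fin n × Fin n × Fin n → ℤ :=
  fun t => (g : Matrix (Fin n) (Fin n) ℤ) t.1 t.2.1 *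
    ((g⁻¹ : Matrix.SpecialLinearGroup (Fin n) ℤ) : Matrix (Fin n) (Fin n) ℤ) t.2.2.1 t.2.2.2

theorem auxV_congr {n : ℕ} (N : ℤ) (g h : Matrix.SpecialLinearGroup (Fin n) ℤ) (U : Matrix (Fin n) (Fin n) ℤ)
    (e : (h : Matrix (Fin n) (Fin n) ℤ) = (g : Matrix (Fin n) (Fin n) ℤ) + N • U) (t) :
    N ∣ auxV h t - auxV g t := by
  set g' := ((g⁻¹ : Matrix.SpecialLinearGroup (Fin n) ℤ) : Matrix (Fin n) (Fin n) ℤ) with hg'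
  set h' := ((h⁻¹ : Matrix.SpecialLinearGroup (Fin n) ℤ) : Matrix (Fin n) (Fin n) ℤ) with hh'
  have hkk : (h : Matrix (Fin n) (Fin n) ℤ) * h' = 1 := aux_SL_mul_inv h
  have hgg : g' * (g : Matrix (Fin n) (Fin n) ℤ) = 1 := aux_SL_inv_mul g
  have ek : h' = g' - N • (g' * U * h') := by
    calc h' = (g' * (g : Matrix (Fin n) (Fin n) ℤ)) * h' := by rw [hgg, one_mul]
      _ = g' * ((h : Matrix (Fin n) (Fin n) ℤ) - N • U) * h' := by rw [e, add_sub_cancel_right]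
      _ = g' * ((h : Matrix (Fin n) (Fin n) ℤ) * h') - N • (g' * U * h') := by
          simp only [mul_sub, sub_mul, smul_mul_assoc, mul_smul_comm, mul_assoc]
      _ = _ := by rw [hkk, mul_one]
  have e1 := congrFun (congrFun e t.1) t.2.1
  have e2 := congrFun (congrFun ek t.2.2.1) t.2.2.2
  rw [Matrix.add_apply, Matrix.smul_apply, smul_eq_mul] at e1
  rw [Matrix.sub_apply, Matrix.smul_apply, smul_eq_mul] at e2
  set a := (g' * U * h') t.2.2.1 t.2.2.2
  show N ∣ (h : Matrix (Fin n) (Fin n) ℤ) t.1 t.2.1 * h' t.2.2.1 t.2.2.2 - (g : Matrix (Fin n) (Fin n) ℤ) t.1 t.2.1 * g' t.2.2.1 t.2.2.2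
  rw [e1, e2]
  refine ⟨U t.1 t.2.1 * (g' t.2.2.1 t.2.2.2 - N * a) - (g : Matrix (Fin n) (Fin n) ℤ) t.1 t.2.1 * a, ?_⟩
  ring

theorem aux_clear {ι : Type*} [Finite ι] (S : Set (ι → ℤ)) (y : ι → ℚ)
    (hy : y ∈ Submodule.span ℚ ((fun w : ι → ℤ => fun t => (w t : ℚ)) '' S)) :
    ∃ k : ℤ, k ≠ 0 ∧ ∃ w ∈ AddSubgroup.closure S, (k:ℚ) • y = fun t => (w t : ℚ) := by
  induction hy using Submodule.span_induction with
  | mem x hx =>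
    obtain ⟨w, hw, rfl⟩ := hx
    exact ⟨1, one_ne_zero, w, AddSubgroup.subset_closure hw, by simp⟩
  | zero => exact ⟨1, one_ne_zero, 0, zero_mem _, by ext; simp⟩
  | add x y _ _ hx hy =>
    obtain ⟨k, hk, w, hw, e⟩ := hx
    obtain ⟨l, hl, z, hz, f⟩ := hy
    refine ⟨k * l, mul_ne_zero hk hl, l • w + k • z, add_mem (zsmul_mem hw _) (zsmul_mem hz _), ?_⟩
    ext t
    have e1 := congrFun e t
    have f1 := congrFun f t
    simp at e1 f1 ⊢
    rw [← e1, ← f1]; ring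
  | smul a x _ hx =>
    obtain ⟨k, hk, w, hw, e⟩ := hx
    refine ⟨k * a.den, mul_ne_zero hk (by exact_mod_cast a.den_nz), a.num • w, zsmul_mem hw _, ?_⟩
    ext t
    have e1 := congrFun e t
    simp at e1 ⊢
    rw [← e1]
    have := Rat.mul_den_eq_num a
    rw [← this]; ring

theorem aux_ad_span {n q : ℕ} (hq : q.Prime) (H : Subgroup (Matrix.SpecialLinearGroup (Fin n) ℤ))
    (hD : ∀ m : ℕ, ∀ g : Matrix.SpecialLinearGroup (Fin n) ℤ, ∃ h ∈ H, ∃ U : Matrix (Fin n) (Fin n) ℤ,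
      (h : Matrix (Fin n) (Fin n) ℤ) = (g : Matrix (Fin n) (Fin n) ℤ) + ((q:ℤ)^(m+1)) • U)
    (g : Matrix.SpecialLinearGroup (Fin n) ℤ) :
    ∃ k : ℤ, k ≠ 0 ∧ k • auxV g ∈ AddSubgroup.closure (auxV '' (H : Set _)) := by
  classical
  set cs : (Fin n × Fin n × Fin n × Fin n → ℤ) → (Fin n × Fin n × Fin n × Fin n → ℚ) := fun w => fun t => (w t : ℚ) with hcs
  by_cases hmem : cs (auxV g) ∈ Submodule.span ℚ (cs '' (auxV '' (H : Set _)))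
  · obtain ⟨k, hk, w, hw, e⟩ := aux_clear _ _ hmem
    refine ⟨k, hk, ?_⟩
    have : k • auxV g = w := by
      ext t
      have := congrFun e t
      simp [hcs] at this
      simp
      exact_mod_cast this
    rw [this]; exact hw
  · exfalso
    obtain ⟨f, hf2, hf1⟩ := Submodule.exists_le_ker_of_notMem hmem
    let a : Fin n × Fin n × Fin n × Fin n → ℚ := fun t => f (Pi.single t 1)
    have hfa : ∀ x, f x = ∑ t, a t * x t := by
      intro x
      conv_lhs => rw [← Finset.univ_sum_single x]
      rw [map_sum]
      refine Finset.sum_congr rfl fun t _ => ?_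
      have : Pi.single t (x t) = x t • (Pi.single t 1 : Fin n × Fin n × Fin n × Fin n → ℚ) := by
        rw [← Pi.single_smul]; simp
      rw [this, map_smul, smul_eq_mul, mul_comm]
    obtain ⟨⟨D, hD0⟩, hDi⟩ := IsLocalization.exist_integer_multiples_of_finite (nonZeroDivisors ℤ) a
    have hD0' : (D:ℚ) ≠ 0 := by exact_mod_cast nonZeroDivisors.ne_zero hD0
    choose b hb using hDi
    have hb' : ∀ t, (b t : ℚ) = D * a t := by
      intro t; have := hb t; simpa using this
    let N : ℤ := ∑ t, b t * auxV g t
    have hfb : ∀ k, ((∑ t, b t * auxV k t : ℤ) : ℚ) = D * f (cs (auxV k)) := by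
      intro k
      rw [hfa, Finset.mul_sum]
      push_cast
      refine Finset.sum_congr rfl fun t _ => ?_
      rw [hb', mul_assoc]
    have hN : N ≠ 0 := by
      intro h0
      have := hfb g
      rw [show (∑ t, b t * auxV g t : ℤ) = N from rfl, h0] at this
      rw [Int.cast_zero] at this
      rcases mul_eq_zero.mp this.symm with h | h
      · exact hD0' h
      · exact hf2 h
    have hdiv : ∀ m : ℕ, ((q:ℤ)^(m+1)) ∣ N := by
      intro m
      obtain ⟨h, hh, U, e⟩ := hD m g
      have hh0 : (∑ t, b t * auxV h t : ℤ) = 0 := by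
        have := hfb h
        have h2 : f (cs (auxV h)) = 0 := hf1 (Submodule.subset_span ⟨_, ⟨h, hh, rfl⟩, rfl⟩)
        rw [h2, mul_zero] at this
        exact_mod_cast this
      have : N = - ∑ t, b t * (auxV h t - auxV g t) := by
        simp only [mul_sub, Finset.sum_sub_distrib, hh0]
        simp [N]
      rw [this, dvd_neg]
      exact Finset.dvd_sum fun t _ => (auxV_congr _ g h U e t).mul_left _
    have h1 := Int.le_of_dvd (abs_pos.mpr hN) ((dvd_abs _ _).mpr (hdiv N.natAbs))
    have h2 : N.natAbs < q ^ (N.natAbs + 1) := (Nat.lt_pow_self hq.one_lt).trans (Nat.pow_lt_pow_right hq.one_lt (Nat.lt_succ_self _))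
    rw [Int.abs_eq_natAbs] at h1
    have h3 : q ^ (N.natAbs + 1) ≤ N.natAbs := by exact_mod_cast h1
    omega

theorem aux_large {n q : ℕ} (hn : 2 ≤ n) (hq : q.Prime) (H : Subgroup (Matrix.SpecialLinearGroup (Fin n) ℤ))
    (hD : ∀ m : ℕ, ∀ g : Matrix.SpecialLinearGroup (Fin n) ℤ, ∃ h ∈ H, ∃ U : Matrix (Fin n) (Fin n) ℤ,
      (h : Matrix (Fin n) (Fin n) ℤ) = (g : Matrix (Fin n) (Fin n) ℤ) + ((q:ℤ)^(m+1)) • U) (M : ℕ) :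
    ∃ P : ℕ, ∀ p : ℕ, p.Prime → P < p →
      M < Nat.card (H.map (Matrix.SpecialLinearGroup.map (n := Fin n) (Int.castRingHom (ZMod p)))) := by
  classical
  let i : Fin n := ⟨0, by omega⟩
  let j : Fin n := ⟨1, by omega⟩
  have hij : i ≠ j := by simp [i, j, Fin.ext_iff]
  choose h hh U e using fun k : Fin (M+1) => hD M (auxT i j hij ((k:ℕ):ℤ))
  have hent : ∀ k, (h k : Matrix (Fin n) (Fin n) ℤ) i j = (k:ℕ) + (q:ℤ)^(M+1) * U k i j := by
    intro k
    have := congrFun (congrFun (e k) i) j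
    rw [auxT_coe] at this
    rw [this, Matrix.add_apply, Matrix.add_apply, Matrix.smul_apply, smul_eq_mul]
    simp [hij]
  have hne : ∀ k l, k ≠ l → (h k : Matrix (Fin n) (Fin n) ℤ) i j - (h l : Matrix (Fin n) (Fin n) ℤ) i j ≠ 0 := by
    intro k l hkl h0
    rw [hent, hent] at h0
    have hd : ((q ^ (M+1) : ℕ) : ℤ) ∣ ((k:ℕ):ℤ) - ((l:ℕ):ℤ) := ⟨U l i j - U k i j, by push_cast; linear_combination h0⟩
    have hlt : M + 1 < q ^ (M+1) := Nat.lt_pow_self hq.one_lt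
    have h3 : ((k:ℕ):ℤ) - ((l:ℕ):ℤ) = 0 := by
      apply Int.eq_zero_of_abs_lt_dvd hd
      have := k.2
      have := l.2
      have h5 : ((M + 1 : ℕ) : ℤ) < ((q ^ (M+1) : ℕ) : ℤ) := by exact_mod_cast hlt
      rw [abs_lt]
      constructor <;> omega
    apply hkl
    apply Fin.ext
    omega
  refine ⟨∑ k, ∑ l, ((h k : Matrix (Fin n) (Fin n) ℤ) i j - (h l : Matrix (Fin n) (Fin n) ℤ) i j).natAbs, ?_⟩
  intro p hp hPp
  haveI : Fact p.Prime := ⟨hp⟩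
  let φ : Fin (M+1) → H.map (Matrix.SpecialLinearGroup.map (n := Fin n) (Int.castRingHom (ZMod p))) :=
    fun k => ⟨_, Subgroup.mem_map_of_mem _ (hh k)⟩
  have hφ : Function.Injective φ := by
    intro k l hkl
    by_contra hne'
    have h1 := congrArg (fun x => ((x.1 : Matrix.SpecialLinearGroup (Fin n) (ZMod p)) : Matrix (Fin n) (Fin n) (ZMod p)) i j) hkl
    have h2 : (((h k : Matrix (Fin n) (Fin n) ℤ) i j : ℤ) : ZMod p) = (((h l : Matrix (Fin n) (Fin n) ℤ) i j : ℤ) : ZMod p) := h1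
    rw [← sub_eq_zero, ← Int.cast_sub, ZMod.intCast_zmod_eq_zero_iff_dvd] at h2
    have h3 := Nat.le_of_dvd (Int.natAbs_pos.mpr (hne k l hne')) (Int.natCast_dvd.mp h2)
    have h4 : ((h k : Matrix (Fin n) (Fin n) ℤ) i j - (h l : Matrix (Fin n) (Fin n) ℤ) i j).natAbs ≤ ∑ k, ∑ l, ((h k : Matrix (Fin n) (Fin n) ℤ) i j - (h l : Matrix (Fin n) (Fin n) ℤ) i j).natAbs := by
      refine le_trans ?_ (Finset.single_le_sum (f := fun k => ∑ l, ((h k : Matrix (Fin n) (Fin n) ℤ) i j - (h l : Matrix (Fin n) (Fin n) ℤ) i j).natAbs) (fun _ _ => Nat.zero_le _) (Finset.mem_univ k))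
      exact Finset.single_le_sum (f := fun l => ((h k : Matrix (Fin n) (Fin n) ℤ) i j - (h l : Matrix (Fin n) (Fin n) ℤ) i j).natAbs) (fun _ _ => Nat.zero_le _) (Finset.mem_univ l)
    omega
  have := Nat.card_le_card_of_injective φ hφ
  rw [Nat.card_fin] at this
  omega

theorem aux_alg_irr {n : ℕ} {F : Type*} [Field F] (h2 : (2:F) ≠ 0) (W : Submodule F (Matrix (Fin n) (Fin n) F))
    (h1 : ∀ i j, i ≠ j → ∀ X ∈ W, (1 + Matrix.single i j (1:F)) * X * (1 - Matrix.single i j (1:F)) ∈ W)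
    (h1' : ∀ i j, i ≠ j → ∀ X ∈ W, (1 - Matrix.single i j (1:F)) * X * (1 + Matrix.single i j (1:F)) ∈ W)
    (X : Matrix (Fin n) (Fin n) F) (hX : X ∈ W) (hns : ∀ c, X ≠ Matrix.scalar (Fin n) c) :
    ∀ i j, i ≠ j → Matrix.single i j 1 ∈ W ∧ Matrix.single i i 1 - Matrix.single j j 1 ∈ W := by
  have hA : ∀ i j, i ≠ j → ∀ X ∈ W, X j i • Matrix.single i j (1:F) ∈ W := by
    intro i j hij X hX
    have e : X j i • Matrix.single i j (1:F) = Matrix.single i j 1 * X * Matrix.single i j 1 := by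
      rw [Matrix.single_mul_mul_single]; simp
    have e2 : (2:F) • (Matrix.single i j 1 * X * Matrix.single i j 1)
      = X + X - ((1 + Matrix.single i j (1:F)) * X * (1 - Matrix.single i j (1:F)) + (1 - Matrix.single i j (1:F)) * X * (1 + Matrix.single i j (1:F))) := by
      rw [two_smul]; noncomm_ring
    have := W.sub_mem (W.add_mem hX hX) (W.add_mem (h1 i j hij X hX) (h1' i j hij X hX))
    rw [← e2, ← e] at this
    exact (Submodule.smul_mem_iff _ h2).mp this
  have hB : ∀ i j, i ≠ j → ∀ X ∈ W, Matrix.single i j (1:F) * X - X * Matrix.single i j 1 ∈ W := by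
    intro i j hij X hX
    have e2 : (2:F) • (Matrix.single i j 1 * X - X * Matrix.single i j 1)
      = ((1 + Matrix.single i j (1:F)) * X * (1 - Matrix.single i j (1:F)) - (1 - Matrix.single i j (1:F)) * X * (1 + Matrix.single i j (1:F))) := by
      rw [two_smul]; noncomm_ring
    have := W.sub_mem (h1 i j hij X hX) (h1' i j hij X hX)
    rw [← e2] at this
    exact (Submodule.smul_mem_iff _ h2).mp this
  have hone : ∃ i j, i ≠ j ∧ Matrix.single i j (1:F) ∈ W := by
    by_cases hd : ∃ i j, i ≠ j ∧ X j i ≠ 0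
    · obtain ⟨i, j, hij, hx⟩ := hd
      exact ⟨i, j, hij, (Submodule.smul_mem_iff _ hx).mp (hA i j hij X hX)⟩
    · push Not at hd
      by_cases hdd : ∃ i j, X j j - X i i ≠ 0
      · obtain ⟨i, j, hx⟩ := hdd
        have hij : i ≠ j := by rintro rfl; simp at hx
        refine ⟨i, j, hij, (Submodule.smul_mem_iff _ hx).mp ?_⟩
        convert hB i j hij X hX using 1
        ext a b
        rw [Matrix.sub_apply, Matrix.smul_apply]
        by_cases hai : a = i
        · subst hai
          by_cases hbj : b = j
          · subst hbj; simp
          · simp [hbj, hd b j hbj, Ne.symm hbj]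
        · by_cases hbj : b = j
          · subst hbj; simp [hai, hd i a (Ne.symm hai), Ne.symm hai]
          · simp [hai, hbj, Ne.symm hai]
      · push Not at hdd
        exfalso
        rcases Nat.eq_zero_or_pos n with rfl | hn
        · exact hns 0 (by ext i; exact i.elim0)
        · apply hns (X ⟨0, hn⟩ ⟨0, hn⟩)
          ext a b
          by_cases hab : a = b
          · subst hab
            simp
            exact sub_eq_zero.mp (hdd _ _)
          · simp [hab, hd b a (Ne.symm hab)]
  have D1 : ∀ i j k, i ≠ j → k ≠ j → Matrix.single i j (1:F) ∈ W → Matrix.single k j (1:F) ∈ W := by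
    intro i j k hij hkj h
    by_cases hki : k = i
    · rwa [hki]
    have := hB k i hki _ h
    simpa [hkj.symm] using this
  have D2 : ∀ i j l, i ≠ j → l ≠ i → Matrix.single i j (1:F) ∈ W → Matrix.single i l (1:F) ∈ W := by
    intro i j l hij hli h
    by_cases hlj : l = j
    · rwa [hlj]
    have := hB j l (Ne.symm hlj) _ h
    simpa [hli, hli.symm] using this
  have D3 : ∀ i j, i ≠ j → Matrix.single i j (1:F) ∈ W → Matrix.single j i (1:F) ∈ W := by
    intro i j hij h
    have := hA j i hij.symm _ h
    simpa using this
  obtain ⟨i, j, hij, h⟩ := hone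
  have hall : ∀ k l, k ≠ l → Matrix.single k l (1:F) ∈ W := by
    intro k l hkl
    by_cases hkj : k = j
    · subst hkj
      exact D2 k i l hij.symm hkl.symm (D3 i k hij h)
    · exact D2 k j l hkj hkl.symm (D1 i j k hij hkj h)
  intro k l hkl
  refine ⟨hall k l hkl, ?_⟩
  have := hB k l hkl _ (hall l k hkl.symm)
  simpa using this

theorem aux_adinv {n p : ℕ} [Fact p.Prime] (H : Subgroup (Matrix.SpecialLinearGroup (Fin n) ℤ))
    (W : Submodule (ZMod p) (Matrix (Fin n) (Fin n) (ZMod p)))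
    (hW : ∀ g ∈ H.map (Matrix.SpecialLinearGroup.map (n := Fin n) (Int.castRingHom (ZMod p))), ∀ X ∈ W,
      (g : Matrix (Fin n) (Fin n) (ZMod p)) * X * ((g⁻¹ : Matrix.SpecialLinearGroup (Fin n) (ZMod p)) : Matrix (Fin n) (Fin n) (ZMod p)) ∈ W)
    (g : Matrix.SpecialLinearGroup (Fin n) ℤ) (k : ℤ) (hk : ¬ (p:ℤ) ∣ k)
    (hspan : k • auxV g ∈ AddSubgroup.closure (auxV '' (H : Set _)))
    (g' : Matrix.SpecialLinearGroup (Fin n) (ZMod p)) (hg' : g' = Matrix.SpecialLinearGroup.map (n := Fin n) (Int.castRingHom (ZMod p)) g)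
    (X : Matrix (Fin n) (Fin n) (ZMod p)) (hX : X ∈ W) :
    (g' : Matrix (Fin n) (Fin n) (ZMod p)) * X * ((g'⁻¹ : Matrix.SpecialLinearGroup (Fin n) (ZMod p)) : Matrix (Fin n) (Fin n) (ZMod p)) ∈ W := by
  let Φ : (Fin n × Fin n × Fin n × Fin n → ℤ) →+ Matrix (Fin n) (Fin n) (ZMod p) :=
    { toFun := fun w => Matrix.of fun i l => ∑ c, ∑ b, ((w (i, b, c, l) : ℤ) : ZMod p) * X b c
      map_zero' := by ext i l; simp
      map_add' := fun x y => by ext i l; simp [add_mul, Finset.sum_add_distrib] }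
  have hΦ : ∀ g : Matrix.SpecialLinearGroup (Fin n) ℤ, Φ (auxV g) =
      ((Matrix.SpecialLinearGroup.map (n := Fin n) (Int.castRingHom (ZMod p)) g : Matrix.SpecialLinearGroup (Fin n) (ZMod p)) : Matrix (Fin n) (Fin n) (ZMod p)) * X *
      (((Matrix.SpecialLinearGroup.map (n := Fin n) (Int.castRingHom (ZMod p)) g)⁻¹ : Matrix.SpecialLinearGroup (Fin n) (ZMod p)) : Matrix (Fin n) (Fin n) (ZMod p)) := by
    intro g
    rw [← map_inv]
    ext i l
    rw [Matrix.mul_apply]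
    simp only [Matrix.mul_apply, Finset.sum_mul]
    show ∑ c : Fin n, ∑ b : Fin n, ((auxV g (i, b, c, l) : ℤ) : ZMod p) * X b c = _
    refine Finset.sum_congr rfl fun c _ => Finset.sum_congr rfl fun b _ => ?_
    have e1 : ((Matrix.SpecialLinearGroup.map (n := Fin n) (Int.castRingHom (ZMod p)) g : Matrix.SpecialLinearGroup (Fin n) (ZMod p)) : Matrix (Fin n) (Fin n) (ZMod p)) i b = (((g : Matrix (Fin n) (Fin n) ℤ) i b : ℤ) : ZMod p) := rfl
    have e2 : ((Matrix.SpecialLinearGroup.map (n := Fin n) (Int.castRingHom (ZMod p)) g⁻¹ : Matrix.SpecialLinearGroup (Fin n) (ZMod p)) : Matrix (Fin n) (Fin n) (ZMod p)) c l = ((((g⁻¹ : Matrix.SpecialLinearGroup (Fin n) ℤ) : Matrix (Fin n) (Fin n) ℤ) c l : ℤ) : ZMod p) := rfl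
    rw [e1, e2]
    simp only [auxV, Int.cast_mul]
    ring
  have hle : AddSubgroup.closure (auxV '' (H : Set _)) ≤ W.toAddSubgroup.comap Φ := by
    rw [AddSubgroup.closure_le]
    rintro _ ⟨h, hh, rfl⟩
    show Φ (auxV h) ∈ W
    rw [hΦ]
    exact hW _ (Subgroup.mem_map_of_mem _ hh) X hX
  have h1 : Φ (k • auxV g) ∈ W := hle hspan
  rw [map_zsmul, hΦ, ← hg', ← Int.cast_smul_eq_zsmul (ZMod p)] at h1
  refine (Submodule.smul_mem_iff _ ?_).mp h1
  rwa [Ne, ZMod.intCast_zmod_eq_zero_iff_dvd]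

theorem aux_adirr {n q : ℕ} (hq : q.Prime) (H : Subgroup (Matrix.SpecialLinearGroup (Fin n) ℤ))
    (hD : ∀ m : ℕ, ∀ g : Matrix.SpecialLinearGroup (Fin n) ℤ, ∃ h ∈ H, ∃ U : Matrix (Fin n) (Fin n) ℤ,
      (h : Matrix (Fin n) (Fin n) ℤ) = (g : Matrix (Fin n) (Fin n) ℤ) + ((q:ℤ)^(m+1)) • U) :
    ∃ P : ℕ, ∀ p : ℕ, [Fact p.Prime] → P < p →
      AdIrr (H.map (Matrix.SpecialLinearGroup.map (n := Fin n) (Int.castRingHom (ZMod p)))) := by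
  classical
  choose k hk0 hk using aux_ad_span hq H hD
  let B : Fin n → Fin n → ℕ := fun i j => if hij : i = j then 0 else (k (auxT i j hij 1)).natAbs + (k (auxT i j hij (-1))).natAbs
  refine ⟨2 + ∑ i, ∑ j, B i j, ?_⟩
  intro p _ hp
  have hB : ∀ i j, B i j < p := by
    intro i j
    have h4 : B i j ≤ ∑ i, ∑ j, B i j := by
      refine le_trans ?_ (Finset.single_le_sum (f := fun i => ∑ j, B i j) (fun _ _ => Nat.zero_le _) (Finset.mem_univ i))
      exact Finset.single_le_sum (f := fun j => B i j) (fun _ _ => Nat.zero_le _) (Finset.mem_univ j)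
    omega
  have hnd : ∀ k : ℤ, k ≠ 0 → k.natAbs < p → ¬ (p:ℤ) ∣ k := by
    intro k hk hlt hdvd
    have := Nat.le_of_dvd (Int.natAbs_pos.mpr hk) (Int.natCast_dvd.mp hdvd)
    omega
  intro W hW X hX hns
  have h2 : (2 : ZMod p) ≠ 0 := by
    intro h
    have : ((2:ℕ) : ZMod p) = 0 := by exact_mod_cast h
    rw [ZMod.natCast_eq_zero_iff] at this
    have := Nat.le_of_dvd (by norm_num) this
    omega
  refine aux_alg_irr h2 W ?_ ?_ X hX hns
  · intro i j hij X hX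
    have hb := hB i j
    simp only [B, dif_neg hij] at hb
    have := aux_adinv H W hW _ _ (hnd _ (hk0 (auxT i j hij 1)) (by omega)) (hk _) (auxT i j hij 1) (by
      apply Subtype.ext
      show _ = Matrix.map _ _
      rw [auxT_coe, auxT_coe]
      ext a b
      simp [Matrix.single_apply, Matrix.one_apply]) X hX
    rwa [auxT_coe, auxT_inv_coe] at this
  · intro i j hij X hX
    have hb := hB i j
    simp only [B, dif_neg hij] at hb
    have := aux_adinv H W hW _ _ (hnd _ (hk0 (auxT i j hij (-1))) (by omega)) (hk _) (auxT i j hij (-1)) (by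
      apply Subtype.ext
      show _ = Matrix.map _ _
      rw [auxT_coe, auxT_coe]
      ext a b
      simp [Matrix.single_apply, Matrix.one_apply]) X hX
    rw [auxT_coe, auxT_inv_coe, ← Matrix.single_neg, sub_neg_eq_add, ← sub_eq_add_neg] at this
    exact this

theorem aux_scalar_of_commute {n : ℕ} {F : Type*} [Field F] (M : Matrix (Fin n) (Fin n) F)
    (h : ∀ i j : Fin n, i ≠ j → Commute (Matrix.single i j (1:F)) M) : ∃ c, M = Matrix.scalar (Fin n) c := by
  obtain ⟨c, hc⟩ := Matrix.mem_range_scalar_of_commute_single (M := M) (fun i j hij => h i j hij)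
  exact ⟨c, hc.symm⟩

theorem aux_center {n : ℕ} {F : Type*} [Field F] (G : Subgroup (Matrix.SpecialLinearGroup (Fin n) F))
    (hG : AdIrr G) (z : G) (hz : z ∈ Subgroup.center G) : z ^ n = 1 := by
  have hcomm : ∀ g ∈ G, Commute (g : Matrix (Fin n) (Fin n) F) ((z : Matrix.SpecialLinearGroup (Fin n) F) : Matrix (Fin n) (Fin n) F) := by
    intro g hg
    have h1 := (Subgroup.mem_center_iff.mp hz) ⟨g, hg⟩
    exact congrArg (fun x : G => ((x : Matrix.SpecialLinearGroup (Fin n) F) : Matrix (Fin n) (Fin n) F)) h1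
  have hsc : ∃ c, ((z : Matrix.SpecialLinearGroup (Fin n) F) : Matrix (Fin n) (Fin n) F) = Matrix.scalar (Fin n) c := by
    by_contra hns
    push Not at hns
    let W : Submodule F (Matrix (Fin n) (Fin n) F) :=
      { carrier := {X | ∀ g ∈ G, Commute (g : Matrix (Fin n) (Fin n) F) X}
        add_mem' := fun h1 h2 g hg => (h1 g hg).add_right (h2 g hg)
        zero_mem' := fun g hg => Commute.zero_right _
        smul_mem' := fun c X hX g hg => (hX g hg).smul_right c }
    have hW : ∀ g ∈ G, ∀ X ∈ W, (g : Matrix (Fin n) (Fin n) F) * X * ((g⁻¹ : Matrix.SpecialLinearGroup (Fin n) F) : Matrix (Fin n) (Fin n) F) ∈ W := by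
      intro g hg X hX
      have : (g : Matrix (Fin n) (Fin n) F) * X = X * g := hX g hg
      rw [this, mul_assoc, aux_SL_mul_inv, mul_one]
      exact hX
    have h1 := hG W hW _ (show ((z : Matrix.SpecialLinearGroup (Fin n) F) : Matrix (Fin n) (Fin n) F) ∈ W from hcomm) hns
    obtain ⟨c, hc⟩ := aux_scalar_of_commute _ (fun i j hij => ((h1 i j hij).1 _ z.2).symm)
    exact hns c hc
  obtain ⟨c, hc⟩ := hsc
  have hdet := (z : Matrix.SpecialLinearGroup (Fin n) F).det_coe
  rw [hc] at hdet
  simp at hdet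
  apply Subtype.ext; apply Subtype.ext
  show (((z : Matrix.SpecialLinearGroup (Fin n) F) ^ n : Matrix.SpecialLinearGroup (Fin n) F) : Matrix (Fin n) (Fin n) F) = 1
  rw [Matrix.SpecialLinearGroup.coe_pow, hc, ← map_pow, hdet, map_one]

theorem aux_noncenter {n : ℕ} {F : Type*} [Field F] (G : Subgroup (Matrix.SpecialLinearGroup (Fin n) F))
    (hG : AdIrr G) (g : G) (hg : g ∉ Subgroup.center G) : ∃ x, ¬ Commute g (x * g * x⁻¹) := by
  have hns : ∀ c, ((g : Matrix.SpecialLinearGroup (Fin n) F) : Matrix (Fin n) (Fin n) F) ≠ Matrix.scalar (Fin n) c := by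
    intro c hc
    apply hg
    rw [Subgroup.mem_center_iff]
    intro x
    apply Subtype.ext; apply Subtype.ext
    show ((x : Matrix.SpecialLinearGroup (Fin n) F) : Matrix (Fin n) (Fin n) F) * ((g : Matrix.SpecialLinearGroup (Fin n) F) : Matrix (Fin n) (Fin n) F) = ((g : Matrix.SpecialLinearGroup (Fin n) F) : Matrix (Fin n) (Fin n) F) * ((x : Matrix.SpecialLinearGroup (Fin n) F) : Matrix (Fin n) (Fin n) F)
    rw [hc]
    exact (Matrix.scalar_commute c (fun r => Commute.all _ _) _).symm
  by_contra hall
  push Not at hall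
  have h1 := hG _ (aux_conj_span G ((g : Matrix.SpecialLinearGroup (Fin n) F) : Matrix (Fin n) (Fin n) F)) ((g : Matrix.SpecialLinearGroup (Fin n) F) : Matrix (Fin n) (Fin n) F)
    (Submodule.subset_span ⟨1, G.one_mem, by simp⟩) hns
  have h2 : ∀ X ∈ Submodule.span F {Y | ∃ k ∈ G, Y = (k : Matrix (Fin n) (Fin n) F) * ((g : Matrix.SpecialLinearGroup (Fin n) F) : Matrix (Fin n) (Fin n) F) * ((k⁻¹ : Matrix.SpecialLinearGroup (Fin n) F) : Matrix (Fin n) (Fin n) F)},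
      Commute X ((g : Matrix.SpecialLinearGroup (Fin n) F) : Matrix (Fin n) (Fin n) F) := by
    intro X hX
    induction hX using Submodule.span_induction with
    | mem x hx =>
      obtain ⟨k, hk, rfl⟩ := hx
      have := hall ⟨k, hk⟩
      exact (congrArg (fun x : G => ((x : Matrix.SpecialLinearGroup (Fin n) F) : Matrix (Fin n) (Fin n) F)) this).symm
    | zero => exact Commute.zero_left _
    | add x y _ _ hx hy => exact hx.add_left hy
    | smul c x _ hx => exact hx.smul_left c
  obtain ⟨c, hc⟩ := aux_scalar_of_commute _ (fun i j hij => h2 _ (h1 i j hij).1)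
  exact hns c hc

theorem aux_final_card {n p : ℕ} [Fact p.Prime] (hn : 2 ≤ n)
    (G : Subgroup (Matrix.SpecialLinearGroup (Fin n) (ZMod p))) (hG : AdIrr G)
    (hdvd : p ∣ Nat.card G) (hnp : n ≤ p)
    (hp : 2 * ((n*n-1) * ((n*n-1)*n)) ^ (n*n-1) < p) : G = ⊤ := by
  obtain ⟨u, hu⟩ := exists_prime_orderOf_dvd_card' p hdvd
  have hpp : p.Prime := Fact.out
  set d := n*n-1 with hd
  set C := d * (d * n) with hC
  have hnn : n * n = d + 1 := by
    have : 0 < n * n := by positivity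
    omega
  have hd0 : 0 < d := by nlinarith
  have hC0 : 0 < C := by positivity
  set m := (p-1) / C with hm
  have hmC : m * C ≤ p - 1 := Nat.div_mul_le_self _ _
  have hp1 := hpp.one_lt
  have h1 : (m+1)^d ≤ Nat.card G := by
    refine aux_unip hnp hn G hG (u : Matrix.SpecialLinearGroup (Fin n) (ZMod p)) u.2 ?_ ?_ ?_
    · intro h
      have : u = 1 := Subtype.ext h
      rw [this, orderOf_one] at hu
      omega
    · have h9 : u ^ p = 1 := orderOf_dvd_iff_pow_eq_one.mp (dvd_of_eq hu)
      exact congrArg Subtype.val h9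
    · rw [← hd]
      have : d * m * (d * n) = m * C := by rw [hC]; ring
      rw [this]; omega
  have h2 : p ≤ (m+1) * C := by
    have := Nat.lt_div_mul_add (a := p-1) hC0
    rw [← hm] at this
    have e : (m+1) * C = m * C + C := by ring
    omega
  have h3 : p ^ d ≤ Nat.card G * C ^ d := by
    calc p ^ d ≤ ((m+1) * C)^d := Nat.pow_le_pow_left h2 _
      _ = (m+1)^d * C^d := mul_pow _ _ _
      _ ≤ _ := Nat.mul_le_mul_right _ h1
  have h4 := aux_card_SL (n := n) (p := p) (by omega)
  rw [hnn] at h4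
  apply aux_big_top
  set S := Nat.card (Matrix.SpecialLinearGroup (Fin n) (ZMod p)) with hS
  set g := Nat.card G with hg
  have hg0 : 0 < g := Nat.card_pos
  have h5 : S * (p-1) ≤ p * (g * C^d) := by
    calc S * (p-1) ≤ p^(d+1) := h4
      _ = p * p^d := by ring
      _ ≤ _ := Nat.mul_le_mul_left _ h3
  have h6 : p ≤ 2 * (p-1) := by omega
  have h7 : S * (p - 1) < (p * g) * (p - 1) := by
    have h8 : C ^ d < p - 1 := by
      have : 0 < C^d := by positivity
      omega
    calc S * (p-1) ≤ (p * g) * C^d := by rw [mul_assoc]; exact h5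
      _ < _ := Nat.mul_lt_mul_of_pos_left h8 (by positivity)
  exact Nat.lt_of_mul_lt_mul_right h7

/-- For prime `n`, if `φ_q(H) = SL(n,ℤ/qℤ)` for one prime `q > 3`, then
`φ_p(H) = SL(n,ℤ/pℤ)` for all but finitely many primes `p`. -/
theorem surjective_for_one_prime_implies_cofinitely (n q : ℕ) (hn : n.Prime)
    (H : Subgroup (SL n ℤ)) (hFG : H.FG) (hq : q.Prime) (hq3 : 3 < q)
    (hsurj : H.map (redMod n q) = ⊤) :
    {p : ℕ | p.Prime ∧ H.map (redMod n p) ≠ ⊤}.Finite := by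
  classical
  have hn2 : 2 ≤ n := hn.two_le
  have hS : ∀ g : Matrix.SpecialLinearGroup (Fin n) ℤ, ∃ h ∈ H, ∃ U : Matrix (Fin n) (Fin n) ℤ,
      (h : Matrix (Fin n) (Fin n) ℤ) = (g : Matrix (Fin n) (Fin n) ℤ) + (q:ℤ) • U := by
    intro g
    have : redMod n q g ∈ H.map (redMod n q) := by rw [hsurj]; trivial
    obtain ⟨h, hh, e⟩ := this
    have hdiv : ∀ i j, ∃ u : ℤ, (h : Matrix (Fin n) (Fin n) ℤ) i j - (g : Matrix (Fin n) (Fin n) ℤ) i j = (q:ℤ) * u := by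
      intro i j
      have h1 := congrArg (fun x => ((x : SL n (ZMod q)) : Matrix (Fin n) (Fin n) (ZMod q)) i j) e
      have h2 : (((h : Matrix (Fin n) (Fin n) ℤ) i j : ℤ) : ZMod q) = (((g : Matrix (Fin n) (Fin n) ℤ) i j : ℤ) : ZMod q) := h1
      rw [← sub_eq_zero, ← Int.cast_sub, ZMod.intCast_zmod_eq_zero_iff_dvd] at h2
      exact h2
    choose U hU using hdiv
    refine ⟨h, hh, Matrix.of U, ?_⟩
    ext i j
    rw [Matrix.add_apply, Matrix.smul_apply, Matrix.of_apply, smul_eq_mul, ← hU]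
    ring
  have hD := aux_dense hq hq3 H hS
  obtain ⟨M, hM⟩ := aux_jordan n (by omega)
  obtain ⟨P1, hP1⟩ := aux_large hn2 hq H hD M
  obtain ⟨P2, hP2⟩ := aux_adirr hq H hD
  refine Set.Finite.subset (Set.finite_le_nat (P1 + P2 + n + 2 * ((n*n-1) * ((n*n-1)*n)) ^ (n*n-1))) ?_
  rintro p ⟨hp, hne⟩
  by_contra hlt
  simp only [Set.mem_setOf_eq, not_le] at hlt
  apply hne
  haveI : Fact p.Prime := ⟨hp⟩
  have hI : AdIrr (H.map (redMod n p)) := hP2 p (by omega)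
  refine aux_final_card hn2 _ hI ?_ (by omega) (by omega)
  by_contra hnd
  obtain ⟨σ, hσ⟩ := aux_lift _ hnd
  have h1 := hM _ σ hσ (aux_center _ hI) (aux_noncenter _ hI)
  have h2 : M < Nat.card (H.map (redMod n p)) := hP1 p hp (by omega)
  exact absurd h2 (not_lt.mpr h1)
end

section
/- Let n > 2 be odd and let h ∈ SL(n,ℤ) have characteristic polynomial that is irreducible over ℚ. Then there is no invertible matrix Φ ∈ GL(n,ℚ) with h Φ hᵀ = Φ. Consequently, no subgroup of SL(n,ℤ) containing such an element h preserves a nondegenerate bilinear form on ℚ^n. -/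
open Matrix

/-- For odd `n > 2`, an element `h ∈ SL(n,ℤ)` with irreducible characteristic
polynomial over `ℚ` preserves no nondegenerate bilinear form; consequently no subgroup
containing `h` is an isometry group. -/
theorem irreducible_element_no_invariant_form (n : ℕ) (hn2 : 2 < n) (hodd : Odd n)
    (h : SL n ℤ) (hirr : Irreducible (matQ h).charpoly) :
    (¬ ∃ Φ : Matrix (Fin n) (Fin n) ℚ, IsUnit Φ ∧ matQ h * Φ * (matQ h)ᵀ = Φ) ∧
    ∀ G : Subgroup (SL n ℤ), h ∈ G → ¬ IsometryGroupQ G := by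
  have key : ¬ ∃ Φ : Matrix (Fin n) (Fin n) ℚ, IsUnit Φ ∧ matQ h * Φ * (matQ h)ᵀ = Φ := by
    rintro ⟨Φ, hΦ, hinv⟩
    have hdet : (matQ h).det = 1 := by
      have h1 : matQ h = (Int.castRingHom ℚ).mapMatrix (h : Matrix (Fin n) (Fin n) ℤ) := rfl
      rw [h1, ← RingHom.map_det, h.det_coe, map_one]
    set A := matQ h with hA
    have e : (A - 1) * Φ * Aᵀ = Φ * (1 - A)ᵀ := by
      rw [Matrix.sub_mul, Matrix.sub_mul, hinv, Matrix.transpose_sub, Matrix.mul_sub]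
      simp
    have e2 := congrArg Matrix.det e
    have hneg : (A - 1).det = - (1 - A).det := by
      rw [← neg_sub 1 A, Matrix.det_neg, Fintype.card_fin, hodd.neg_one_pow]
      ring
    have hΦd : Φ.det ≠ 0 := ((Matrix.isUnit_iff_isUnit_det Φ).1 hΦ).ne_zero
    simp only [Matrix.det_mul, Matrix.det_transpose, hdet, hneg] at e2
    have hz : (1 - A).det = 0 := by
      have : Φ.det * (1 - A).det = 0 := by linarith
      exact (mul_eq_zero.1 this).resolve_left hΦd
    have hroot : A.charpoly.IsRoot 1 := by
      rw [Polynomial.IsRoot, Matrix.eval_charpoly]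
      simpa using hz
    have hd := Polynomial.degree_eq_one_of_irreducible_of_root hirr hroot
    rw [Matrix.charpoly_degree_eq_dim, Fintype.card_fin] at hd
    have : n = 1 := by exact_mod_cast hd
    omega
  refine ⟨key, ?_⟩
  rintro G hG ⟨Φ, hΦ, hinv⟩
  exact key ⟨Φ, hΦ, hinv h hG⟩
end
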